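/- Let k ≥ 2 be an integer, let α_1, …, α_{k−1}, γ_1, …, γ_{k−1} ∈ ℝ, and assume that the multiplicative exponent of α = (α_1, …, α_{k−1}) satisfies ω^×(α) < (k−1)/(k−2) (for k = 2 this condition reads ω^×(α) < ∞). Let ψ : ℕ → ℝ_{≥0} be a decreasing function such that Σ_{n=1}^∞ ψ(n)(log n)^{k−1} = ∞. Then for Lebesgue-almost all α ∈ ℝ there exist infinitely many n ∈ ℕ such that ‖nα_1 − γ_1‖ ⋯ ‖nα_{k−1} − γ_{k−1}‖ · ‖nα‖ < ψ(n). -/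

import Mathlib

open scoped BigOperators
open Filter MeasureTheory

/-- Distance from `x` to the nearest integer. -/
noncomputable def dn (x : ℝ) : ℝ := |x - round x|

/-- Multiplicative exponent `ω^×(α)`: the supremum of the set of real numbers `w` such
that `‖nα₁‖⋯‖nα_d‖ < n^{-w}` holds for infinitely many `n ∈ ℕ`. -/
noncomputable def multExp {d : ℕ} (α : Fin d → ℝ) : EReal :=
  sSup {w : EReal | ∃ v : ℝ, w = (v : ℝ) ∧
    {n : ℕ | 0 < n ∧ ∏ i, dn (n * α i) < (n : ℝ) ^ (-v)}.Infinite}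

/-- The bound `(k-1)/(k-2)`, read as `∞` when `k = 2`. -/
noncomputable def mBound (k : ℕ) : EReal :=
  if k = 2 then ⊤ else ((((k : ℝ) - 1) / ((k : ℝ) - 2) : ℝ) : EReal)

/-- The additive character `x ↦ exp (2 * π * i * x)` of `ℝ`. -/
noncomputable def ee (x : ℝ) : ℂ := Complex.exp (Complex.I * ((2 * Real.pi * x : ℝ) : ℂ))

lemma ee_add (x y : ℝ) : ee (x + y) = ee x * ee y := by
  unfold ee; rw [← Complex.exp_add]; push_cast; ring_nf

lemma ee_zero : ee 0 = 1 := by simp [ee]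

lemma norm_ee (x : ℝ) : ‖ee x‖ = 1 := by
  unfold ee; rw [mul_comm]; exact Complex.norm_exp_ofReal_mul_I _

lemma conj_ee (x : ℝ) : (starRingEnd ℂ) (ee x) = ee (-x) := by
  unfold ee; rw [← Complex.exp_conj, map_mul, Complex.conj_I, Complex.conj_ofReal]
  push_cast; ring_nf

lemma ee_sum {ι : Type*} (s : Finset ι) (f : ι → ℝ) : ee (∑ i ∈ s, f i) = ∏ i ∈ s, ee (f i) := by
  classical
  induction s using Finset.induction_on with
  | empty => simp [ee_zero]
  | insert a s ha ih => rw [Finset.sum_insert ha, Finset.prod_insert ha, ee_add, ih]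

lemma ee_nat_mul (n : ℕ) (x : ℝ) : ee (n * x) = ee x ^ n := by
  unfold ee; rw [← Complex.exp_nat_mul]; push_cast; ring_nf

lemma dn_nonneg (x : ℝ) : 0 ≤ dn x := abs_nonneg _

lemma dn_le_half (x : ℝ) : dn x ≤ 1 / 2 := abs_sub_round x

lemma dn_le_abs_sub_int (x : ℝ) (m : ℤ) : dn x ≤ |x - m| := round_le x m

lemma dn_int (m : ℤ) : dn m = 0 := by simp [dn]

lemma four_mul_dn_le (x : ℝ) : 4 * dn x ≤ ‖ee x - 1‖ := by
  unfold ee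
  rw [Complex.norm_exp_I_mul_ofReal_sub_one]
  have h1 : 2 * Real.pi * x / 2 = Real.pi * (x - round x) + (round x : ℤ) * Real.pi := by ring
  rw [h1, Real.sin_add_int_mul_pi, norm_mul, norm_mul, norm_zpow]
  simp only [norm_neg, norm_one, one_zpow, one_mul, Real.norm_eq_abs]
  have hpi := Real.pi_pos
  have h2 : |Real.pi * (x - round x)| = Real.pi * dn x := by
    rw [abs_mul, abs_of_pos hpi]; rfl
  have h3 := Real.mul_abs_le_abs_sin (x := Real.pi * (x - round x)) (by
    rw [h2]; nlinarith [dn_le_half x])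
  rw [h2] at h3
  have : 2 / Real.pi * (Real.pi * dn x) = 2 * dn x := by field_simp
  rw [this] at h3
  norm_num
  linarith

lemma norm_geom_sum_mul_dn_le (N : ℕ) (x : ℝ) :
    ‖∑ n ∈ Finset.range N, ee (n * x)‖ * dn x ≤ 1 / 2 := by
  simp_rw [ee_nat_mul]
  have h := congrArg norm (geom_sum_mul (ee x) N)
  rw [norm_mul] at h
  have h2 : ‖ee x ^ N - 1‖ ≤ 2 := by
    refine (norm_sub_le _ _).trans ?_
    rw [norm_pow, norm_ee]; norm_num
  nlinarith [four_mul_dn_le x, norm_nonneg (∑ i ∈ Finset.range N, ee x ^ i)]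

lemma norm_geom_sum_Ico_mul_dn_le (a b : ℕ) (x : ℝ) :
    ‖∑ n ∈ Finset.Ico a b, ee (n * x)‖ * dn x ≤ 1 / 2 := by
  rw [Finset.sum_Ico_eq_sum_range]
  have : ∀ n : ℕ, ee (((a + n : ℕ) : ℝ) * x) = ee (a * x) * ee (n * x) := by
    intro n; rw [← ee_add]; push_cast; ring_nf
  simp_rw [this, ← Finset.mul_sum, norm_mul, norm_ee, one_mul]
  exact norm_geom_sum_mul_dn_le _ _

/-- The Fejér kernel of order `H`. -/
noncomputable def fejer (H : ℕ) (x : ℝ) : ℝ :=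
  ‖∑ h ∈ Finset.range H, ee (h * x)‖ ^ 2 / H

lemma fejer_nonneg (H : ℕ) (x : ℝ) : 0 ≤ fejer H x := by unfold fejer; positivity

lemma fejer_le (H : ℕ) (x : ℝ) : fejer H x ≤ H := by
  have h : ‖∑ h ∈ Finset.range H, ee (h * x)‖ ≤ H := by
    refine (norm_sum_le _ _).trans ?_
    simp [norm_ee]
  unfold fejer
  refine div_le_of_le_mul₀ (by positivity) (by positivity) ?_
  rw [← sq]
  gcongr

lemma fejer_mul_dn_sq_le (H : ℕ) (x : ℝ) : fejer H x * dn x ^ 2 ≤ 1 / (4 * H) := by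
  have h := norm_geom_sum_mul_dn_le H x
  unfold fejer
  have h2 : (‖∑ n ∈ Finset.range H, ee (n * x)‖ * dn x) ^ 2 ≤ (1 / 2) ^ 2 := by
    have := dn_nonneg x
    gcongr
  calc _ = (‖∑ n ∈ Finset.range H, ee (n * x)‖ * dn x) ^ 2 / H := by ring
    _ ≤ (1 / 2) ^ 2 / H := by gcongr
    _ = _ := by ring

lemma fejer_eq_sum (H : ℕ) (x : ℝ) :
    (fejer H x : ℂ) = ∑ p ∈ Finset.range H ×ˢ Finset.range H,
      ((1 / H : ℝ) : ℂ) * ee ((((p.1 : ℤ) - (p.2 : ℤ) : ℤ) : ℝ) * x) := by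
  unfold fejer
  push_cast
  rw [← Complex.mul_conj', map_sum, Finset.sum_mul_sum, ← Finset.sum_product', ← Finset.mul_sum,
    div_eq_mul_one_div, mul_comm]
  congr 1
  refine Finset.sum_congr rfl fun p _ => ?_
  rw [conj_ee, ← ee_add]
  ring_nf

/-- A nonnegative trigonometric polynomial of degree less than `2 ^ T` with mean value `T` which is
majorised by a multiple of `1 / ‖x‖`. -/
noncomputable def logKernel (T : ℕ) (x : ℝ) : ℝ := ∑ t ∈ Finset.range T, fejer (2 ^ t) x

lemma logKernel_nonneg (T : ℕ) (x : ℝ) : 0 ≤ logKernel T x :=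
  Finset.sum_nonneg fun _ _ => fejer_nonneg _ _

lemma logKernel_le (T : ℕ) (x : ℝ) : logKernel T x ≤ 2 ^ T := by
  calc logKernel T x ≤ ∑ t ∈ Finset.range T, (2 : ℝ) ^ t :=
        Finset.sum_le_sum fun t _ => (fejer_le _ _).trans (by simp)
    _ ≤ 2 ^ T := by rw [geom_sum_eq (by norm_num)]; norm_num

lemma sum_min_le (T : ℕ) (y : ℝ) (hy : 1 ≤ y) :
    ∑ t ∈ Finset.range T, min ((2 : ℝ) ^ t) (y ^ 2 / 2 ^ t) ≤ 4 * y := by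
  obtain ⟨s, hs1, hs2⟩ := exists_nat_pow_near hy (one_lt_two)
  have key : ∀ T : ℕ, ∑ t ∈ Finset.range T, min ((2 : ℝ) ^ t) (y ^ 2 / 2 ^ t) ≤
      if T ≤ s + 1 then 2 ^ T else 4 * y - 2 * y ^ 2 / 2 ^ T := by
    intro T
    induction T with
    | zero => simp
    | succ T ih =>
      rw [Finset.sum_range_succ]
      by_cases h : T + 1 ≤ s + 1
      · rw [if_pos h]
        rw [if_pos (by omega)] at ih
        have := min_le_left ((2 : ℝ) ^ T) (y ^ 2 / 2 ^ T)
        have h6 : (2 : ℝ) ^ (T + 1) = 2 * 2 ^ T := by ring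
        linarith
      · rw [if_neg h]
        have h3 := min_le_right ((2 : ℝ) ^ T) (y ^ 2 / 2 ^ T)
        have h4 : 2 * y ^ 2 / 2 ^ (T + 1) = y ^ 2 / 2 ^ T := by
          rw [show (2 : ℝ) ^ (T + 1) = 2 * 2 ^ T by ring]; field_simp
        rw [h4]
        by_cases h' : T ≤ s + 1
        · have : T = s + 1 := by omega
          subst this
          rw [if_pos le_rfl] at ih
          have h5 : y ^ 2 / 2 ^ (s + 1) ≤ y := by
            rw [div_le_iff₀ (by positivity)]; nlinarith
          have : (2 : ℝ) ^ (s + 1) ≤ 2 * y := by rw [pow_succ]; linarith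
          linarith
        · rw [if_neg h'] at ih
          have : 2 * y ^ 2 / 2 ^ T = y ^ 2 / 2 ^ T + y ^ 2 / 2 ^ T := by ring
          linarith
  refine (key T).trans ?_
  split_ifs with h
  · calc (2 : ℝ) ^ T ≤ 2 ^ (s + 1) := by gcongr; norm_num
      _ ≤ 4 * y := by rw [pow_succ]; linarith
  · have : 0 ≤ 2 * y ^ 2 / 2 ^ T := by positivity
    linarith

lemma logKernel_mul_dn_le (T : ℕ) (x : ℝ) : logKernel T x * dn x ≤ 2 := by
  rcases (dn_nonneg x).eq_or_lt with h0 | h0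
  · rw [← h0]; norm_num
  set y := 1 / (2 * dn x) with hy
  have hy1 : 1 ≤ y := by
    rw [hy, le_div_iff₀ (by positivity)]; linarith [dn_le_half x]
  have h : logKernel T x ≤ 4 * y := by
    refine le_trans (Finset.sum_le_sum fun t _ => le_min ?_ ?_) (sum_min_le T y hy1)
    · exact (fejer_le _ _).trans (by simp)
    · have := fejer_mul_dn_sq_le (2 ^ t) x
      rw [← le_div_iff₀ (by positivity)] at this
      refine this.trans (le_of_eq ?_)
      rw [hy]; push_cast; field_simp; norm_num
  have : 4 * y * dn x = 2 := by rw [hy]; field_simp; norm_num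
  nlinarith

/-- Index set of the frequencies of `logKernel T`. -/
def freqSet (T : ℕ) : Finset (Σ _ : ℕ, ℕ × ℕ) :=
  (Finset.range T).sigma fun t => Finset.range (2 ^ t) ×ˢ Finset.range (2 ^ t)

/-- Frequency attached to an index. -/
def freq (s : Σ _ : ℕ, ℕ × ℕ) : ℤ := (s.2.1 : ℤ) - s.2.2

/-- Coefficient attached to an index. -/
noncomputable def coeffWeight (s : Σ _ : ℕ, ℕ × ℕ) : ℝ := 1 / 2 ^ s.1

lemma coeffWeight_nonneg (s : Σ _ : ℕ, ℕ × ℕ) : 0 ≤ coeffWeight s := by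
  unfold coeffWeight; positivity

lemma logKernel_eq_sum (T : ℕ) (x : ℝ) :
    (logKernel T x : ℂ) = ∑ s ∈ freqSet T, (coeffWeight s : ℂ) * ee (freq s * x) := by
  unfold logKernel freqSet
  rw [Finset.sum_sigma]
  push_cast
  refine Finset.sum_congr rfl fun t _ => ?_
  rw [fejer_eq_sum]
  refine Finset.sum_congr rfl fun p _ => ?_
  simp [coeffWeight, freq]

lemma abs_freq_le (T : ℕ) {s : Σ _ : ℕ, ℕ × ℕ} (hs : s ∈ freqSet T) : |freq s| ≤ 2 ^ T := by
  simp only [freqSet, Finset.mem_sigma, Finset.mem_range, Finset.mem_product] at hs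
  obtain ⟨h1, h2, h3⟩ := hs
  have : 2 ^ s.1 ≤ 2 ^ T := Nat.pow_le_pow_right (by norm_num) h1.le
  unfold freq
  have h4 : ((2 ^ T : ℕ) : ℤ) = 2 ^ T := by push_cast; rfl
  rw [abs_le]
  constructor <;> omega

lemma sum_coeffWeight_freq_zero (T : ℕ) :
    ∑ s ∈ freqSet T, (if freq s = 0 then coeffWeight s else 0) = T := by
  unfold freqSet
  rw [Finset.sum_sigma]
  have : ∀ t ∈ Finset.range T, ∑ p ∈ Finset.range (2 ^ t) ×ˢ Finset.range (2 ^ t),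
      (if freq ⟨t, p⟩ = 0 then coeffWeight ⟨t, p⟩ else 0) = (1 : ℝ) := by
    intro t _
    rw [Finset.sum_product]
    have h : ∀ a ∈ Finset.range (2 ^ t), ∑ b ∈ Finset.range (2 ^ t),
        (if freq ⟨t, (a, b)⟩ = 0 then coeffWeight ⟨t, (a, b)⟩ else 0) = (1 / 2 ^ t : ℝ) := by
      intro a ha
      simp only [freq, coeffWeight, sub_eq_zero, Nat.cast_inj]
      rw [Finset.sum_ite_eq, if_pos ha]
    rw [Finset.sum_congr rfl h]
    simp
  rw [Finset.sum_congr rfl this]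
  simp

lemma sum_coeffWeight_le (T : ℕ) : ∑ s ∈ freqSet T, coeffWeight s ≤ 2 ^ T := by
  unfold freqSet
  rw [Finset.sum_sigma]
  calc _ ≤ ∑ t ∈ Finset.range T, (2 : ℝ) ^ t := by
        refine Finset.sum_le_sum fun t _ => le_of_eq ?_
        simp [coeffWeight, Finset.sum_const, Finset.card_product]
    _ ≤ 2 ^ T := by rw [geom_sum_eq (by norm_num)]; norm_num

/-- The product weight attached to the inhomogeneous linear forms `n α_i - γ_i`. -/
noncomputable def prodWeight {d : ℕ} (T : ℕ) (α γ : Fin d → ℝ) (n : ℕ) : ℝ :=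
  ∏ i, logKernel T (n * α i - γ i)

lemma prodWeight_nonneg {d : ℕ} (T : ℕ) (α γ : Fin d → ℝ) (n : ℕ) : 0 ≤ prodWeight T α γ n :=
  Finset.prod_nonneg fun _ _ => logKernel_nonneg _ _

lemma prodWeight_le {d : ℕ} (T : ℕ) (α γ : Fin d → ℝ) (n : ℕ) :
    prodWeight T α γ n ≤ (2 ^ T) ^ d := by
  unfold prodWeight
  calc _ ≤ ∏ _i : Fin d, (2 : ℝ) ^ T :=
        Finset.prod_le_prod (fun _ _ => logKernel_nonneg _ _) fun _ _ => logKernel_le _ _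
    _ = _ := by simp

lemma prodWeight_mul_prod_dn_le {d : ℕ} (T : ℕ) (α γ : Fin d → ℝ) (n : ℕ) :
    prodWeight T α γ n * ∏ i, dn (n * α i - γ i) ≤ 2 ^ d := by
  unfold prodWeight
  rw [← Finset.prod_mul_distrib]
  calc _ ≤ ∏ _i : Fin d, (2 : ℝ) :=
        Finset.prod_le_prod (fun _ _ => mul_nonneg (logKernel_nonneg _ _) (dn_nonneg _))
          fun _ _ => logKernel_mul_dn_le _ _
    _ = _ := by simp

lemma prodWeight_eq_sum {d : ℕ} (T : ℕ) (α γ : Fin d → ℝ) (n : ℕ) :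
    (prodWeight T α γ n : ℂ) = ∑ f ∈ Fintype.piFinset (fun _ : Fin d => freqSet T),
      ((∏ i, coeffWeight (f i) : ℝ) : ℂ) * ee (-∑ i, freq (f i) * γ i) *
        ee (n * ∑ i, freq (f i) * α i) := by
  unfold prodWeight
  push_cast
  simp_rw [logKernel_eq_sum]
  rw [Finset.prod_univ_sum]
  refine Finset.sum_congr rfl fun f _ => ?_
  rw [Finset.prod_mul_distrib, ← ee_sum, mul_assoc, ← ee_add]
  congr 2
  rw [Finset.mul_sum, ← Finset.sum_neg_distrib, ← Finset.sum_add_distrib]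
  exact Finset.sum_congr rfl fun i _ => by ring

lemma abs_sum_prodWeight_sub_le {d : ℕ} (T q : ℕ) (α γ : Fin d → ℝ) (ρ : ℝ) (hρ : 0 < ρ)
    (h : ∀ m : Fin d → ℤ, m ≠ 0 → (∀ i, |m i| ≤ 2 ^ T) → ρ ≤ dn (q * ∑ i, m i * α i))
    (a b : ℕ) (hab : a ≤ b) :
    |∑ n ∈ Finset.Ico a b, prodWeight T α γ (q * n) - T ^ d * ((b : ℝ) - a)| ≤
      (2 ^ T) ^ d / (2 * ρ) := by
  set F := Fintype.piFinset (fun _ : Fin d => freqSet T) with hF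
  set C : (Fin d → (Σ _ : ℕ, ℕ × ℕ)) → ℝ := fun f => ∏ i, coeffWeight (f i) with hC
  have hC0 : ∀ f, 0 ≤ C f := fun f => Finset.prod_nonneg fun _ _ => coeffWeight_nonneg _
  have hCsum : ∑ f ∈ F, C f ≤ (2 ^ T) ^ d := by
    rw [hF, hC, ← Finset.prod_univ_sum]
    calc _ ≤ ∏ _i : Fin d, (2 : ℝ) ^ T :=
          Finset.prod_le_prod (fun _ _ => Finset.sum_nonneg fun _ _ => coeffWeight_nonneg _)
            fun _ _ => sum_coeffWeight_le T
      _ = _ := by simp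
  have hdiag : ∑ f ∈ F, (if ∀ i, freq (f i) = 0 then C f else 0) = (T : ℝ) ^ d := by
    have : ∀ f : Fin d → (Σ _ : ℕ, ℕ × ℕ), (if ∀ i, freq (f i) = 0 then C f else 0) =
        ∏ i, (if freq (f i) = 0 then coeffWeight (f i) else 0) := by
      intro f
      split_ifs with h0
      · exact Finset.prod_congr rfl fun i _ => by rw [if_pos (h0 i)]
      · push Not at h0
        obtain ⟨i, hi⟩ := h0
        exact (Finset.prod_eq_zero (Finset.mem_univ i) (by rw [if_neg hi])).symm
    simp_rw [this]
    rw [hF, ← Finset.prod_univ_sum (fun _ : Fin d => freqSet T)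
      (fun _ s => if freq s = 0 then coeffWeight s else 0), Finset.prod_congr rfl
      fun _ _ => sum_coeffWeight_freq_zero T]
    simp
  have key : ((∑ n ∈ Finset.Ico a b, prodWeight T α γ (q * n) - T ^ d * ((b : ℝ) - a) : ℝ) : ℂ) =
      ∑ f ∈ F, (C f : ℂ) * (ee (-∑ i, freq (f i) * γ i) *
        (∑ n ∈ Finset.Ico a b, ee (n * (q * ∑ i, freq (f i) * α i))) -
        if ∀ i, freq (f i) = 0 then ((b : ℂ) - a) else 0) := by
    rw [← hdiag]
    push_cast
    rw [Finset.sum_mul]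
    simp_rw [prodWeight_eq_sum]
    rw [Finset.sum_comm, ← Finset.sum_sub_distrib]
    refine Finset.sum_congr rfl fun f _ => ?_
    rw [mul_sub (C f : ℂ)]
    congr 1
    · rw [← mul_assoc, Finset.mul_sum]
      refine Finset.sum_congr rfl fun n _ => ?_
      congr 2
      push_cast; ring
    · split_ifs <;> simp
  rw [← Real.norm_eq_abs, ← Complex.norm_real, key]
  calc _ ≤ ∑ f ∈ F, C f * (1 / (2 * ρ)) := by
        refine norm_sum_le_of_le _ fun f hf => ?_
        rw [norm_mul, Complex.norm_real, Real.norm_of_nonneg (hC0 f)]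
        refine mul_le_mul_of_nonneg_left ?_ (hC0 f)
        by_cases h0 : ∀ i, freq (f i) = 0
        · simp only [h0]
          simp only [Int.cast_zero, zero_mul, Finset.sum_const_zero, mul_zero, neg_zero, ee_zero]
          simp [Nat.cast_sub hab]
          positivity
        · rw [if_neg h0, sub_zero, norm_mul, norm_ee, one_mul]
          have h1 := h (fun i => freq (f i)) (fun h' => h0 fun i => congrFun h' i)
            (fun i => abs_freq_le T (Fintype.mem_piFinset.1 hf i))
          have h2 := norm_geom_sum_Ico_mul_dn_le a b (q * ∑ i, freq (f i) * α i)
          rw [le_div_iff₀ (by positivity)]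
          nlinarith [norm_nonneg (∑ n ∈ Finset.Ico a b, ee (n * (q * ∑ i, freq (f i) * α i)))]
    _ = (∑ f ∈ F, C f) * (1 / (2 * ρ)) := by rw [Finset.sum_mul]
    _ ≤ (2 ^ T) ^ d * (1 / (2 * ρ)) := by gcongr
    _ = _ := by ring

lemma dn_neg (x : ℝ) : dn (-x) = dn x := by
  unfold dn; rw [← UnitAddCircle.norm_eq, ← UnitAddCircle.norm_eq, AddCircle.coe_neg, norm_neg]

lemma dn_add_int (x : ℝ) (m : ℤ) : dn (x + m) = dn x := by
  unfold dn; rw [round_add_intCast]; push_cast; ring_nf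

lemma dn_eq_norm (x : ℝ) : dn x = ‖(x : UnitAddCircle)‖ := UnitAddCircle.norm_eq.symm

/-- Simultaneous Dirichlet approximation, by the pigeonhole principle. -/
lemma exists_nat_dn_le {ι : Type*} [Fintype ι] [DecidableEq ι] (α : ι → ℝ) (Q : ℕ) (hQ : 0 < Q) :
    ∃ n : ℕ, 0 < n ∧ n ≤ Q ^ Fintype.card ι ∧ ∀ i, dn (n * α i) ≤ 1 / Q := by
  have hQ' : (0 : ℝ) < Q := by exact_mod_cast hQ
  have hfl : ∀ x : ℝ, ⌊Int.fract x * Q⌋₊ < Q := fun x => by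
    rw [Nat.floor_lt (by positivity)]
    nlinarith [Int.fract_lt_one x]
  let F : ℕ → (ι → Fin Q) := fun n i => ⟨⌊Int.fract (n * α i) * Q⌋₊, hfl _⟩
  obtain ⟨x, hx, y, hy, hxy, hF⟩ := Finset.exists_ne_map_eq_of_card_lt_of_maps_to
    (s := Finset.range (Q ^ Fintype.card ι + 1)) (t := Finset.univ) (f := F)
    (by simp) (fun _ _ => Finset.mem_coe.2 (Finset.mem_univ _))
  have main : ∀ x y : ℕ, x < y → y < Q ^ Fintype.card ι + 1 → F x = F y →
      ∃ n : ℕ, 0 < n ∧ n ≤ Q ^ Fintype.card ι ∧ ∀ i, dn (n * α i) ≤ 1 / Q := by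
    intro x y hlt hy hF
    refine ⟨y - x, by omega, by omega, fun i => ?_⟩
    have h1 := Fin.mk.inj_iff.1 (congrFun hF i)
    have a1 := Nat.floor_le (a := Int.fract (x * α i) * Q) (by positivity)
    have a2 := Nat.lt_floor_add_one (Int.fract (x * α i) * Q)
    have b1 := Nat.floor_le (a := Int.fract (y * α i) * Q) (by positivity)
    have b2 := Nat.lt_floor_add_one (Int.fract (y * α i) * Q)
    rw [h1] at a1 a2
    refine (dn_le_abs_sub_int _ (⌊y * α i⌋ - ⌊x * α i⌋)).trans ?_
    have : ((y - x : ℕ) : ℝ) * α i - ((⌊y * α i⌋ - ⌊x * α i⌋ : ℤ) : ℝ) =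
        Int.fract (y * α i) - Int.fract (x * α i) := by
      rw [Nat.cast_sub hlt.le]; unfold Int.fract; push_cast; ring
    rw [this, le_div_iff₀ hQ']
    rcases abs_cases (Int.fract (y * α i) - Int.fract (x * α i)) with ⟨h, -⟩ | ⟨h, -⟩ <;> rw [h] <;>
      nlinarith
  simp only [Finset.mem_range] at hx hy
  rcases lt_or_gt_of_ne hxy with h | h
  · exact main x y h hy hF
  · exact main y x h hx hF.symm

/-- A finite multiplicative exponent gives a uniform lower bound for products of distances. -/
lemma exists_lower_bound_of_multExp_lt {d : ℕ} (α : Fin d → ℝ) (v : ℝ)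
    (hv : multExp α < (v : EReal)) :
    ∃ c : ℝ, 0 < c ∧ ∀ n : ℕ, 0 < n → c * (n : ℝ) ^ (-v) ≤ ∏ i, dn (n * α i) := by
  have hfin : {n : ℕ | 0 < n ∧ ∏ i, dn (n * α i) < (n : ℝ) ^ (-v)}.Finite := by
    by_contra hinf
    exact absurd (le_sSup (show (v : EReal) ∈ {w : EReal | ∃ v : ℝ, w = (v : ℝ) ∧
      {n : ℕ | 0 < n ∧ ∏ i, dn (n * α i) < (n : ℝ) ^ (-v)}.Infinite} from ⟨v, rfl, hinf⟩))
      (not_le.2 hv)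
  have hpos : ∀ n : ℕ, 0 < n → 0 < ∏ i, dn (n * α i) := by
    intro n hn
    by_contra hle
    have h0 : ∏ i, dn (n * α i) = 0 :=
      le_antisymm (not_lt.1 hle) (Finset.prod_nonneg fun _ _ => dn_nonneg _)
    obtain ⟨i, -, hi⟩ := Finset.prod_eq_zero_iff.1 h0
    refine (Set.infinite_of_injective_forall_mem (f := fun k : ℕ => n * (k + 1))
      (fun a b hab => by simpa [hn.ne'] using hab) fun k =>
        (show 0 < n * (k + 1) ∧ ∏ i, dn ((n * (k + 1) : ℕ) * α i) <
          ((n * (k + 1) : ℕ) : ℝ) ^ (-v) from ⟨by positivity, ?_⟩)) hfin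
    have : dn ((n * (k + 1) : ℕ) * α i) = 0 := by
      have h1 : (n : ℝ) * α i = round (n * α i) := by
        unfold dn at hi; linarith [abs_eq_zero.1 hi]
      have : ((n * (k + 1) : ℕ) : ℝ) * α i = ((round (n * α i) * (k + 1) : ℤ) : ℝ) := by
        push_cast; rw [← h1]; ring
      rw [this, dn_int]
    rw [Finset.prod_eq_zero (Finset.mem_univ i) this]
    positivity
  have hex : ∃ c : ℝ, 0 < c ∧ ∀ n ∈ hfin.toFinset,
      c * (n : ℝ) ^ (-v) ≤ ∏ i, dn (n * α i) := by
    generalize hs : hfin.toFinset = s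
    have hs' : ∀ n ∈ s, 0 < n := fun n hn => by
      rw [← hs] at hn; exact (hfin.mem_toFinset.1 hn).1
    clear hs
    induction s using Finset.induction_on with
    | empty => exact ⟨1, one_pos, by simp⟩
    | insert a s ha ih =>
      obtain ⟨c, hc, hcs⟩ := ih fun n hn => hs' n (Finset.mem_insert_of_mem hn)
      have ha0 := hs' a (Finset.mem_insert_self _ _)
      have haR : (0 : ℝ) < a := by exact_mod_cast ha0
      have hpw : (0 : ℝ) < (a : ℝ) ^ (-v) := Real.rpow_pos_of_pos haR _
      refine ⟨min c ((∏ i, dn (a * α i)) / (a : ℝ) ^ (-v)),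
        lt_min hc (div_pos (hpos a ha0) hpw), fun n hn => ?_⟩
      rcases Finset.mem_insert.1 hn with rfl | hn
      · refine (mul_le_mul_of_nonneg_right (min_le_right _ _) hpw.le).trans (le_of_eq ?_)
        field_simp
      · exact (mul_le_mul_of_nonneg_right (min_le_left _ _) (by positivity)).trans (hcs n hn)
  obtain ⟨c, hc, hcs⟩ := hex
  refine ⟨min c 1, lt_min hc one_pos, fun n hn => ?_⟩
  by_cases hmem : n ∈ hfin.toFinset
  · exact (mul_le_mul_of_nonneg_right (min_le_left _ _) (by positivity)).trans (hcs n hmem)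
  · have : ¬ (∏ i, dn (n * α i) < (n : ℝ) ^ (-v)) := fun h =>
      hmem (hfin.mem_toFinset.2 ⟨hn, h⟩)
    refine (mul_le_mul_of_nonneg_right (min_le_right _ _) (by positivity)).trans ?_
    rw [one_mul]; exact not_lt.1 this

lemma dn_add_le (x y : ℝ) : dn (x + y) ≤ dn x + dn y := by
  simp only [dn_eq_norm, AddCircle.coe_add]; exact norm_add_le _ _

lemma dn_int_mul_le (m : ℤ) (x : ℝ) : dn (m * x) ≤ |(m : ℝ)| * dn x := by
  refine (dn_le_abs_sub_int _ (m * round x)).trans (le_of_eq ?_)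
  unfold dn; rw [← abs_mul]; push_cast; ring_nf

lemma dn_nat_mul_le (n : ℕ) (x : ℝ) : dn (n * x) ≤ n * dn x := by
  simpa using dn_int_mul_le n x

lemma dn_sum_le {ι : Type*} (s : Finset ι) (f : ι → ℝ) :
    dn (∑ i ∈ s, f i) ≤ ∑ i ∈ s, dn (f i) := by
  classical
  induction s using Finset.induction_on with
  | empty => simp [dn]
  | insert a s ha ih =>
    rw [Finset.sum_insert ha, Finset.sum_insert ha]
    exact (dn_add_le _ _).trans (by linarith)

/-- Transference step: a very small value of an integral linear form in the `α_i` yields a good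
simultaneous approximation. -/
lemma transference_step {d : ℕ} (α : Fin d → ℝ) (m : Fin d → ℤ) (hm : m ≠ 0) (R Q : ℕ)
    (hR : ∀ i, |m i| ≤ R) (hQ : 0 < Q)
    (hτ : dn (∑ i, m i * α i) ≤ 1 / (Q : ℝ) ^ d) :
    ∃ n : ℕ, 0 < n ∧ n ≤ R * Q ^ (d - 1) ∧ ∏ i, dn (n * α i) ≤ (d * R / Q : ℝ) ^ d := by
  obtain ⟨i₀, hi₀⟩ : ∃ i, m i ≠ 0 := Function.ne_iff.1 hm
  have hQ' : (0 : ℝ) < Q := by exact_mod_cast hQ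
  have hRabs : ∀ i, |(m i : ℝ)| ≤ R := fun i => by exact_mod_cast hR i
  have hRn : (m i₀).natAbs ≤ R := by
    zify; exact hR i₀
  have hR1 : 1 ≤ R := (Int.natAbs_pos.2 hi₀).trans_le hRn
  have hR1' : (1 : ℝ) ≤ R := by exact_mod_cast hR1
  have hd : 0 < d := Fin.pos i₀
  obtain ⟨n, hn, hnQ, hnα⟩ := exists_nat_dn_le (fun i : {i : Fin d // i ≠ i₀} => α i) Q hQ
  have hcard : Fintype.card {i : Fin d // i ≠ i₀} = d - 1 := by
    simp [Fintype.card_subtype_compl]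
  rw [hcard] at hnQ
  have hnα' : ∀ i, i ≠ i₀ → dn (n * α i) ≤ 1 / Q := fun i hi => hnα ⟨i, hi⟩
  have hd1 : (1 : ℝ) ≤ d := by exact_mod_cast hd
  have hscaled : ∀ i, i ≠ i₀ → dn (m i * (n * α i)) ≤ R / Q := fun i hi => by
    refine (dn_int_mul_le _ _).trans ?_
    calc |(m i : ℝ)| * dn (n * α i) ≤ R * (1 / Q) :=
          mul_le_mul (hRabs i) (hnα' i hi) (dn_nonneg _) (by positivity)
      _ = _ := by ring
  refine ⟨(m i₀).natAbs * n, Nat.mul_pos (Int.natAbs_pos.2 hi₀) hn,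
    Nat.mul_le_mul hRn hnQ, ?_⟩
  have hall : ∀ i, dn (((m i₀).natAbs * n : ℕ) * α i) ≤ d * R / Q := by
    intro i
    have hle : (R : ℝ) / Q ≤ d * R / Q := by gcongr; nlinarith
    by_cases hi : i = i₀
    · subst hi
      have h1 : dn (((m i).natAbs * n : ℕ) * α i) = dn (m i * (n * α i)) := by
        have h2 : (((m i).natAbs : ℕ) : ℝ) = |(m i : ℝ)| := by
          rw [Nat.cast_natAbs]; push_cast; rfl
        push_cast
        rw [h2]
        rcases abs_choice (m i : ℝ) with h | h <;> rw [h]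
        · ring_nf
        · rw [← dn_neg]; ring_nf
      rw [h1]
      have h3 : (m i : ℝ) * (n * α i) = n * (∑ j, m j * α j) +
          ∑ j ∈ Finset.univ.erase i, -(m j * (n * α j)) := by
        rw [← Finset.add_sum_erase _ _ (Finset.mem_univ i), mul_add, Finset.mul_sum,
          Finset.sum_neg_distrib]
        have : ∀ j, (n : ℝ) * (m j * α j) = m j * (n * α j) := fun j => by ring
        simp_rw [this]
        ring
      rw [h3]
      have h4 : dn (n * (∑ j, m j * α j)) ≤ R / Q := by
        refine (dn_nat_mul_le _ _).trans ?_
        calc (n : ℝ) * dn (∑ j, m j * α j) ≤ (Q : ℝ) ^ (d - 1) * (1 / (Q : ℝ) ^ d) :=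
              mul_le_mul (by exact_mod_cast hnQ) hτ (dn_nonneg _) (by positivity)
          _ = 1 / Q := by
              obtain ⟨e, rfl⟩ : ∃ e, d = e + 1 := ⟨d - 1, by omega⟩
              rw [Nat.add_sub_cancel, pow_succ]; field_simp
          _ ≤ R / Q := by gcongr
      have h5 : dn (∑ j ∈ Finset.univ.erase i, -(m j * (n * α j))) ≤ (d - 1) * (R / Q) := by
        refine (dn_sum_le _ _).trans ?_
        calc _ ≤ ∑ j ∈ Finset.univ.erase i, (R / Q : ℝ) :=
              Finset.sum_le_sum fun j hj => by
                rw [dn_neg]; exact hscaled j (Finset.ne_of_mem_erase hj)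
          _ = _ := by
              rw [Finset.sum_const, Finset.card_erase_of_mem (Finset.mem_univ _)]
              simp [Nat.cast_sub (show 1 ≤ d from hd)]
      refine (dn_add_le _ _).trans ((add_le_add h4 h5).trans (le_of_eq ?_))
      ring
    · refine le_trans ?_ hle
      have : (((m i₀).natAbs * n : ℕ) : ℝ) * α i = ((m i₀).natAbs : ℕ) * (n * α i) := by
        push_cast; ring
      rw [this]
      refine (dn_nat_mul_le _ _).trans ?_
      have h2 : (((m i₀).natAbs : ℕ) : ℝ) ≤ R := by exact_mod_cast hRn
      calc _ ≤ (R : ℝ) * (1 / Q) := mul_le_mul h2 (hnα' i hi) (dn_nonneg _) (by positivity)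
        _ = _ := by ring
  calc _ ≤ ∏ _i : Fin d, (d * R / Q : ℝ) :=
        Finset.prod_le_prod (fun _ _ => dn_nonneg _) fun i _ => hall i
    _ = _ := by rw [Finset.prod_const, Finset.card_univ, Fintype.card_fin]

/-- A lower bound for `‖nα_1‖⋯‖nα_d‖` with exponent below `d / (d - 1)` gives a polynomial lower
bound for the dual linear form. -/
lemma exists_dual_lower_bound {d : ℕ} (α : Fin d → ℝ) (v c : ℝ) (hc : 0 < c) (hv : 0 ≤ v)
    (hvd : ((d : ℝ) - 1) * v < d)
    (h : ∀ n : ℕ, 0 < n → c * (n : ℝ) ^ (-v) ≤ ∏ i, dn (n * α i)) :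
    ∃ (A : ℕ) (c' : ℝ), 0 < c' ∧ ∀ (R : ℕ) (m : Fin d → ℤ), m ≠ 0 → (∀ i, |m i| ≤ R) →
      c' / (R : ℝ) ^ A ≤ dn (∑ i, m i * α i) := by
  set e : ℝ := d - (d - 1) * v with he
  have he0 : 0 < e := by rw [he]; linarith
  obtain ⟨B, hB⟩ := exists_nat_ge ((d + v) / e)
  set K : ℝ := ((d : ℝ) ^ d / c) ^ (1 / e) with hK
  have hK0 : 0 ≤ K := by positivity
  refine ⟨B * d, 1 / (K + 1) ^ d, by positivity, fun R m hm hR => ?_⟩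
  obtain ⟨i₀, hi₀⟩ : ∃ i, m i ≠ 0 := Function.ne_iff.1 hm
  have hd : 0 < d := Fin.pos i₀
  have hR1 : 1 ≤ R := by
    have := hR i₀
    have := Int.one_le_abs hi₀
    omega
  have hR1' : (1 : ℝ) ≤ R := by exact_mod_cast hR1
  have hR0 : (0 : ℝ) < R := by linarith
  set Q : ℕ := ⌊K * (R : ℝ) ^ B⌋₊ + 1 with hQdef
  have hQ1 : K * (R : ℝ) ^ B < Q := by rw [hQdef]; push_cast; exact Nat.lt_floor_add_one _
  have hQ2 : (Q : ℝ) ≤ (K + 1) * (R : ℝ) ^ B := by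
    have h1 := Nat.floor_le (a := K * (R : ℝ) ^ B) (by positivity)
    have h2 : (1 : ℝ) ≤ (R : ℝ) ^ B := one_le_pow₀ hR1'
    rw [hQdef]; push_cast; linarith
  have hQpos : 0 < Q := Nat.succ_pos _
  have hQ0 : (0 : ℝ) < Q := by exact_mod_cast hQpos
  by_contra hlt
  push Not at hlt
  have hτ : dn (∑ i, m i * α i) ≤ 1 / (Q : ℝ) ^ d := by
    refine hlt.le.trans ?_
    rw [div_div, pow_mul, ← mul_pow]
    gcongr
  obtain ⟨n, hn, hnle, hprod⟩ := transference_step α m hm R Q hR hQpos hτ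
  have hn0 : (0 : ℝ) < n := by exact_mod_cast hn
  have h1 := (h n hn).trans hprod
  have h2 : ((R : ℝ) * (Q : ℝ) ^ ((d : ℝ) - 1)) ^ (-v) ≤ (n : ℝ) ^ (-v) := by
    refine Real.rpow_le_rpow_of_nonpos hn0 ?_ (by linarith)
    have : ((d : ℝ) - 1) = ((d - 1 : ℕ) : ℝ) := by rw [Nat.cast_sub hd]; simp
    rw [this, Real.rpow_natCast]
    exact_mod_cast hnle
  have h3 : c * ((R : ℝ) * (Q : ℝ) ^ ((d : ℝ) - 1)) ^ (-v) ≤ (d * R / Q : ℝ) ^ d :=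
    (mul_le_mul_of_nonneg_left h2 hc.le).trans h1
  rw [Real.rpow_neg (by positivity), ← div_eq_mul_inv, div_le_iff₀ (by positivity),
    Real.mul_rpow hR0.le (by positivity), ← Real.rpow_mul hQ0.le, div_pow, mul_pow,
    div_mul_eq_mul_div, le_div_iff₀ (by positivity)] at h3
  have hQd : (Q : ℝ) ^ d = (Q : ℝ) ^ e * (Q : ℝ) ^ (((d : ℝ) - 1) * v) := by
    rw [← Real.rpow_add hQ0, ← Real.rpow_natCast]; congr 1; rw [he]; ring
  have hRd : (R : ℝ) ^ d * (R : ℝ) ^ v = (R : ℝ) ^ ((d : ℝ) + v) := by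
    rw [Real.rpow_add hR0, Real.rpow_natCast]
  have hQv : (0 : ℝ) < (Q : ℝ) ^ (((d : ℝ) - 1) * v) := by positivity
  have h4 : c * (Q : ℝ) ^ e ≤ (d : ℝ) ^ d * (R : ℝ) ^ ((d : ℝ) + v) := by
    rw [hQd] at h3
    rw [← hRd]
    refine le_of_mul_le_mul_right ?_ hQv
    calc _ = c * ((Q : ℝ) ^ e * (Q : ℝ) ^ (((d : ℝ) - 1) * v)) := by ring
      _ ≤ _ := h3
      _ = _ := by ring
  have h5 : (K * (R : ℝ) ^ B) ^ e < (Q : ℝ) ^ e :=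
    Real.rpow_lt_rpow (by positivity) hQ1 he0
  have h6 : (K * (R : ℝ) ^ B) ^ e = (d : ℝ) ^ d / c * (R : ℝ) ^ ((B : ℝ) * e) := by
    rw [Real.mul_rpow hK0 (by positivity), hK, ← Real.rpow_mul (by positivity),
      one_div_mul_cancel he0.ne', Real.rpow_one, ← Real.rpow_natCast (R : ℝ) B,
      ← Real.rpow_mul hR0.le]
  have h7 : (R : ℝ) ^ ((d : ℝ) + v) ≤ (R : ℝ) ^ ((B : ℝ) * e) :=
    Real.rpow_le_rpow_of_exponent_le hR1' (by rwa [div_le_iff₀ he0] at hB)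
  have h8 : (d : ℝ) ^ d / c * (R : ℝ) ^ ((d : ℝ) + v) < (Q : ℝ) ^ e :=
    lt_of_le_of_lt (by gcongr) (h6 ▸ h5)
  have h9 : (d : ℝ) ^ d * (R : ℝ) ^ ((d : ℝ) + v) < c * (Q : ℝ) ^ e := by
    calc _ = c * ((d : ℝ) ^ d / c * (R : ℝ) ^ ((d : ℝ) + v)) := by field_simp
      _ < _ := by gcongr
  linarith

lemma exp_neg_two_mul_le (x : ℝ) (h0 : 0 ≤ x) (h1 : x ≤ 1 / 2) : Real.exp (-(2 * x)) ≤ 1 - x := by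
  rw [Real.exp_neg, inv_le_comm₀ (Real.exp_pos _) (by linarith)]
  have h2 : (1 - x)⁻¹ ≤ 2 * x + 1 := by
    rw [inv_le_comm₀ (by linarith) (by linarith), inv_le_iff_one_le_mul₀ (by linarith)]
    nlinarith
  exact h2.trans (Real.add_one_le_exp _)

/-- Sum of the reciprocals of the prime factors. -/
noncomputable def primeRecipSum (n : ℕ) : ℝ := ∑ p ∈ n.primeFactors, (p : ℝ)⁻¹

lemma exp_neg_primeRecipSum_le (n : ℕ) (hn : 0 < n) :
    Real.exp (-(2 * primeRecipSum n)) ≤ (n.totient : ℝ) / n := by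
  have hn' : (0 : ℝ) < n := by exact_mod_cast hn
  have h := congrArg (fun q : ℚ => (q : ℝ)) (Nat.totient_eq_mul_prod_factors n)
  push_cast at h
  rw [h, mul_div_cancel_left₀ _ hn'.ne', primeRecipSum, Finset.mul_sum, ← Finset.sum_neg_distrib,
    Real.exp_sum]
  refine Finset.prod_le_prod (fun _ _ => (Real.exp_pos _).le) fun p hp => ?_
  have hp2 : (2 : ℝ) ≤ p := by exact_mod_cast (Nat.prime_of_mem_primeFactors hp).two_le
  refine exp_neg_two_mul_le _ (by positivity) ?_
  rw [one_div]; gcongr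

lemma two_pow_card_primeFactors_le (n : ℕ) (hn : 0 < n) : 2 ^ n.primeFactors.card ≤ n :=
  (Finset.pow_card_le_prod _ _ _ fun _ hp => (Nat.prime_of_mem_primeFactors hp).two_le).trans
    (Nat.le_of_dvd hn (Nat.prod_primeFactors_dvd n))

lemma primeRecipSum_le (n j P : ℕ) (hn : 0 < n) (hnj : n < 2 ^ (j + 1)) (hP : j + 1 ≤ P) :
    primeRecipSum n ≤ 1 + ∑ q ∈ Finset.Ioc 1 P, if q ∣ n then (q : ℝ)⁻¹ else 0 := by
  have hP0 : (0 : ℝ) < P := by exact_mod_cast (by omega : 0 < P)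
  unfold primeRecipSum
  rw [← Finset.sum_filter_add_sum_filter_not _ (fun p => P < p)]
  refine add_le_add ?_ ?_
  · calc _ ≤ ∑ p ∈ n.primeFactors with P < p, (P : ℝ)⁻¹ := by
          refine Finset.sum_le_sum fun p hp => ?_
          have : (P : ℝ) ≤ p := by exact_mod_cast (Finset.mem_filter.1 hp).2.le
          gcongr
      _ ≤ n.primeFactors.card * (P : ℝ)⁻¹ := by
          rw [Finset.sum_const, nsmul_eq_mul]
          gcongr
          exact Finset.filter_subset _ _
      _ ≤ P * (P : ℝ)⁻¹ := by
          gcongr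
          have h1 := (two_pow_card_primeFactors_le n hn).trans_lt hnj
          have := (Nat.pow_lt_pow_iff_right (by norm_num : 1 < 2)).1 h1
          omega
      _ = 1 := by field_simp
  · rw [← Finset.sum_filter]
    refine Finset.sum_le_sum_of_subset_of_nonneg ?_ fun _ _ _ => by positivity
    intro p hp
    simp only [Finset.mem_filter, Finset.mem_Ioc] at hp ⊢
    exact ⟨⟨(Nat.prime_of_mem_primeFactors hp.1).one_lt, not_lt.1 hp.2⟩,
      Nat.dvd_of_mem_primeFactors hp.1⟩

/-- Jensen-type inequality: if the weighted average of the sum of reciprocals of prime factors is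
at most `K`, then the weighted average of `φ(n)/n` is at least `exp (-2 * K)`. -/
lemma sum_totient_div_ge (s : Finset ℕ) (hs : ∀ n ∈ s, 0 < n) (w : ℕ → ℝ) (hw : ∀ n, 0 ≤ w n)
    (K : ℝ) (hK : ∑ n ∈ s, w n * primeRecipSum n ≤ K * ∑ n ∈ s, w n) :
    Real.exp (-(2 * K)) * ∑ n ∈ s, w n ≤ ∑ n ∈ s, w n * ((n.totient : ℝ) / n) := by
  have h : ∀ n ∈ s, Real.exp (-(2 * K)) * (w n + 2 * (K * w n) - 2 * (w n * primeRecipSum n)) ≤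
      w n * ((n.totient : ℝ) / n) := by
    intro n hn
    calc _ = w n * (Real.exp (-(2 * K)) * (2 * K - 2 * primeRecipSum n + 1)) := by ring
      _ ≤ w n * (Real.exp (-(2 * K)) * Real.exp (2 * K - 2 * primeRecipSum n)) := by
          gcongr
          · exact hw n
          · exact Real.add_one_le_exp _
      _ = w n * Real.exp (-(2 * primeRecipSum n)) := by rw [← Real.exp_add]; ring_nf
      _ ≤ _ := mul_le_mul_of_nonneg_left (exp_neg_primeRecipSum_le n (hs n hn)) (hw n)
  refine le_trans ?_ (Finset.sum_le_sum h)
  rw [← Finset.mul_sum, Finset.sum_sub_distrib, Finset.sum_add_distrib, ← Finset.mul_sum,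
    ← Finset.mul_sum, ← Finset.mul_sum]
  gcongr
  linarith

section Block

variable {d : ℕ} {α γ : Fin d → ℝ} {A : ℕ} {c : ℝ}

lemma abs_sum_prodWeight_sub_le_of_dual (hc : 0 < c)
    (hdual : ∀ (R : ℕ) (m : Fin d → ℤ), m ≠ 0 → (∀ i, |m i| ≤ R) →
      c / (R : ℝ) ^ A ≤ dn (∑ i, m i * α i)) (T q : ℕ) (hq : 0 < q) (hqT : q ≤ 2 ^ T)
    (a b : ℕ) (hab : a ≤ b) :
    |∑ n ∈ Finset.Ico a b, prodWeight T α γ (q * n) - T ^ d * ((b : ℝ) - a)| ≤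
      2 ^ (T * (d + 2 * A)) / (2 * c) := by
  have h := abs_sum_prodWeight_sub_le T q α γ (c / ((2 ^ T * 2 ^ T : ℕ) : ℝ) ^ A) (by positivity)
    (fun m hm hmT => ?_) a b hab
  · refine h.trans (le_of_eq ?_)
    push_cast
    field_simp
    ring
  · have := hdual (2 ^ T * 2 ^ T) (fun i => q * m i) (fun h0 => hm (funext fun i => by
      have := congrFun h0 i
      simp only [Pi.zero_apply, mul_eq_zero, Nat.cast_eq_zero] at this
      exact this.resolve_left hq.ne')) (fun i => by
        rw [abs_mul, Nat.abs_cast]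
        push_cast
        exact mul_le_mul (by exact_mod_cast hqT) (hmT i) (abs_nonneg _) (by positivity))
    refine this.trans (le_of_eq ?_)
    congr 1
    rw [Finset.mul_sum]
    exact Finset.sum_congr rfl fun i _ => by push_cast; ring

lemma sum_prodWeight_dvd_le (hc : 0 < c)
    (hdual : ∀ (R : ℕ) (m : Fin d → ℤ), m ≠ 0 → (∀ i, |m i| ≤ R) →
      c / (R : ℝ) ^ A ≤ dn (∑ i, m i * α i)) (j T q : ℕ) (hq : 0 < q) (hqT : q ≤ 2 ^ T)
    (hT : 0 < T) (hTj : T ≤ j)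
    (hE : (2 : ℝ) ^ (T * (d + 2 * A)) / (2 * c) * 2 ^ T ≤ 2 ^ j / 2) :
    ∑ n ∈ Finset.Ico (2 ^ j) (2 ^ (j + 1)), (if q ∣ n then prodWeight T α γ n else 0) ≤
      4 * (T ^ d * 2 ^ j / q) := by
  have hq0 : (0 : ℝ) < q := by exact_mod_cast hq
  have hqT' : (q : ℝ) ≤ 2 ^ T := by exact_mod_cast hqT
  have hT1 : (1 : ℝ) ≤ T := by exact_mod_cast hT
  set a := 2 ^ j / q with ha
  set b := 2 ^ (j + 1) / q + 1 with hb
  have hab : a ≤ b := by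
    have : 2 ^ j / q ≤ 2 ^ (j + 1) / q :=
      Nat.div_le_div_right (Nat.pow_le_pow_right (by norm_num) (by omega))
    omega
  have h1 : ∑ n ∈ Finset.Ico (2 ^ j) (2 ^ (j + 1)), (if q ∣ n then prodWeight T α γ n else 0) ≤
      ∑ n ∈ Finset.Ico a b, prodWeight T α γ (q * n) := by
    rw [← Finset.sum_filter, ← Finset.sum_image (s := Finset.Ico a b) (g := fun n => q * n)
      (f := fun n => prodWeight T α γ n) (fun x _ y _ h => Nat.eq_of_mul_eq_mul_left hq h)]
    refine Finset.sum_le_sum_of_subset_of_nonneg ?_ fun _ _ _ => prodWeight_nonneg _ _ _ _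
    intro n hn
    simp only [Finset.mem_filter, Finset.mem_Ico, Finset.mem_image] at hn ⊢
    obtain ⟨⟨h2, h3⟩, k, rfl⟩ := hn
    refine ⟨k, ⟨?_, ?_⟩, rfl⟩
    · rw [ha]; exact Nat.div_le_of_le_mul h2
    · rw [hb, Nat.lt_succ_iff, Nat.le_div_iff_mul_le hq, mul_comm]; exact h3.le
  have h2 := (abs_le.1 (abs_sum_prodWeight_sub_le_of_dual (γ := γ) hc hdual T q hq hqT a b hab)).2
  have hE2 : (2 : ℝ) ^ (T * (d + 2 * A)) / (2 * c) ≤ 2 ^ j / q := by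
    rw [le_div_iff₀ hq0]
    calc _ ≤ (2 : ℝ) ^ (T * (d + 2 * A)) / (2 * c) * 2 ^ T := by gcongr
      _ ≤ 2 ^ j / 2 := hE
      _ ≤ 2 ^ j := by linarith [show (0 : ℝ) < 2 ^ j by positivity]
  have hqj : (1 : ℝ) ≤ 2 ^ j / q := by
    rw [le_div_iff₀ hq0, one_mul]
    exact hqT'.trans (by gcongr; norm_num)
  have hba : (b : ℝ) - a ≤ 2 ^ j / q + 2 := by
    have hb' : (b : ℝ) ≤ 2 ^ (j + 1) / q + 1 := by
      rw [hb]; push_cast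
      have := @Nat.cast_div_le ℝ _ _ _ (2 ^ (j + 1)) q
      push_cast at this; linarith
    have ha' : (2 : ℝ) ^ j / q ≤ a + 1 := by
      have : 2 ^ j < q * (a + 1) := by
        rw [ha]; exact Nat.lt_mul_div_succ _ hq
      rw [div_le_iff₀ hq0]
      have h3 : (2 : ℝ) ^ j < q * (a + 1) := by exact_mod_cast this
      linarith
    have : (2 : ℝ) ^ (j + 1) / q = 2 * (2 ^ j / q) := by ring
    linarith
  have hTd : (1 : ℝ) ≤ (T : ℝ) ^ d := one_le_pow₀ hT1
  set X := (2 : ℝ) ^ j / q with hX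
  calc _ ≤ _ := h1
    _ ≤ T ^ d * ((b : ℝ) - a) + X := by linarith
    _ ≤ T ^ d * (X + 2) + X := by gcongr
    _ ≤ 4 * (T ^ d * X) := by nlinarith
    _ = _ := by rw [hX]; ring

lemma le_sum_prodWeight (hc : 0 < c)
    (hdual : ∀ (R : ℕ) (m : Fin d → ℤ), m ≠ 0 → (∀ i, |m i| ≤ R) →
      c / (R : ℝ) ^ A ≤ dn (∑ i, m i * α i)) (j T : ℕ) (hT : 0 < T)
    (hE : (2 : ℝ) ^ (T * (d + 2 * A)) / (2 * c) * 2 ^ T ≤ 2 ^ j / 2) :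
    T ^ d * 2 ^ j / 2 ≤ ∑ n ∈ Finset.Ico (2 ^ j) (2 ^ (j + 1)), prodWeight T α γ n := by
  have hT1 : (1 : ℝ) ≤ T := by exact_mod_cast hT
  have h := (abs_le.1 (abs_sum_prodWeight_sub_le_of_dual (γ := γ) hc hdual T 1 one_pos
    Nat.one_le_two_pow (2 ^ j) (2 ^ (j + 1)) (Nat.pow_le_pow_right (by norm_num) (by omega)))).1
  simp only [one_mul] at h
  push_cast at h
  have hE2 : (2 : ℝ) ^ (T * (d + 2 * A)) / (2 * c) ≤ 2 ^ j / 2 := by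
    refine le_trans ?_ hE
    exact le_mul_of_one_le_right (by positivity) (one_le_pow₀ (by norm_num))
  have hTd : (1 : ℝ) ≤ (T : ℝ) ^ d := one_le_pow₀ hT1
  have h2 : (2 : ℝ) ^ (j + 1) - 2 ^ j = 2 ^ j := by ring
  rw [h2] at h
  have h3 : (0 : ℝ) < 2 ^ j := by positivity
  nlinarith

lemma sum_prodWeight_totient_ge (hc : 0 < c)
    (hdual : ∀ (R : ℕ) (m : Fin d → ℤ), m ≠ 0 → (∀ i, |m i| ≤ R) →
      c / (R : ℝ) ^ A ≤ dn (∑ i, m i * α i)) (j T : ℕ) (hT : 0 < T) (hTj : T ≤ j)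
    (hjT : j + 1 ≤ 2 ^ T)
    (hE : (2 : ℝ) ^ (T * (d + 2 * A)) / (2 * c) * 2 ^ T ≤ 2 ^ j / 2) :
    Real.exp (-(2 * 9)) * ∑ n ∈ Finset.Ico (2 ^ j) (2 ^ (j + 1)), prodWeight T α γ n ≤
      ∑ n ∈ Finset.Ico (2 ^ j) (2 ^ (j + 1)), prodWeight T α γ n * ((n.totient : ℝ) / n) := by
  have hpos : ∀ n ∈ Finset.Ico (2 ^ j) (2 ^ (j + 1)), 0 < n := fun n hn =>
    lt_of_lt_of_le (by positivity) (Finset.mem_Ico.1 hn).1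
  refine sum_totient_div_ge _ hpos _ (prodWeight_nonneg _ _ _) _ ?_
  have hlow := le_sum_prodWeight (γ := γ) hc hdual j T hT hE
  set S := ∑ n ∈ Finset.Ico (2 ^ j) (2 ^ (j + 1)), prodWeight T α γ n with hS
  calc _ ≤ ∑ n ∈ Finset.Ico (2 ^ j) (2 ^ (j + 1)), prodWeight T α γ n *
        (1 + ∑ q ∈ Finset.Ioc (1 : ℕ) (2 ^ T), if q ∣ n then (q : ℝ)⁻¹ else 0) :=
        Finset.sum_le_sum fun n hn => mul_le_mul_of_nonneg_left
          (primeRecipSum_le n j _ (hpos n hn) (Finset.mem_Ico.1 hn).2 hjT)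
          (prodWeight_nonneg _ _ _ _)
    _ = S + ∑ q ∈ Finset.Ioc (1 : ℕ) (2 ^ T), (q : ℝ)⁻¹ * ∑ n ∈ Finset.Ico (2 ^ j) (2 ^ (j + 1)),
          (if q ∣ n then prodWeight T α γ n else 0) := by
        simp_rw [mul_add, mul_one, Finset.sum_add_distrib, Finset.mul_sum]
        rw [Finset.sum_comm]
        congr 1
        refine Finset.sum_congr rfl fun q _ => Finset.sum_congr rfl fun n _ => ?_
        split_ifs <;> ring
    _ ≤ S + ∑ q ∈ Finset.Ioc (1 : ℕ) (2 ^ T), (q : ℝ)⁻¹ * (4 * (T ^ d * 2 ^ j / q)) := by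
        gcongr with q hq
        have hq' := Finset.mem_Ioc.1 hq
        exact sum_prodWeight_dvd_le hc hdual j T q (by omega) hq'.2 hT hTj hE
    _ = S + 4 * (T ^ d * 2 ^ j) * ∑ q ∈ Finset.Ioc (1 : ℕ) (2 ^ T), ((q : ℝ) ^ 2)⁻¹ := by
        rw [Finset.mul_sum]
        congr 1
        refine Finset.sum_congr rfl fun q _ => ?_
        rw [div_eq_mul_inv, sq, mul_inv]; ring
    _ ≤ S + 4 * (T ^ d * 2 ^ j) * 1 := by
        gcongr
        refine (sum_Ioc_inv_sq_le_sub one_ne_zero Nat.one_le_two_pow).trans ?_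
        simp
    _ ≤ 9 * S := by linarith

end Block

lemma exists_block_scale (d A : ℕ) (c : ℝ) (hc : 0 < c) :
    ∃ L J : ℕ, 0 < L ∧ ∀ j, J ≤ j → 0 < j / L ∧ j / L ≤ j ∧ (j / L) * (d + 1) ≤ j ∧
      j + 1 ≤ 2 ^ (j / L) ∧
      (2 : ℝ) ^ ((j / L) * (d + 2 * A)) / (2 * c) * 2 ^ (j / L) ≤ 2 ^ j / 2 := by
  set L := d + 2 * A + 2 with hL
  have hL0 : 0 < L := by omega
  obtain ⟨T₁, hT₁⟩ := pow_unbounded_of_one_lt (1 / c) (one_lt_two)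
  have h2 : ∀ᶠ T : ℕ in atTop, ((T : ℝ) ^ 1 + 1) * L ≤ 2 ^ T := by
    have h3 := (tendsto_pow_const_div_const_pow_of_one_lt 1 (one_lt_two (α := ℝ))).const_mul
      (2 * L : ℝ)
    rw [mul_zero] at h3
    filter_upwards [h3.eventually_lt_const one_pos, eventually_ge_atTop 1] with T hT hT1
    have hT1' : (1 : ℝ) ≤ T := by exact_mod_cast hT1
    have h4 : (0 : ℝ) < 2 ^ T := by positivity
    rw [← mul_div_assoc, div_lt_one h4] at hT
    have : (0 : ℝ) < L := by exact_mod_cast hL0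
    nlinarith
  obtain ⟨T₂, hT₂⟩ := eventually_atTop.1 h2
  refine ⟨L, (T₁ + T₂ + 1) * L, hL0, fun j hj => ?_⟩
  have hT : T₁ + T₂ + 1 ≤ j / L := (Nat.le_div_iff_mul_le hL0).2 hj
  have hjL : j / L * L ≤ j := Nat.div_mul_le_self j L
  have hjlt : j < L * (j / L + 1) := Nat.lt_mul_div_succ _ hL0
  set T := j / L with hTdef
  refine ⟨by omega, Nat.div_le_self _ _, le_trans (Nat.mul_le_mul_left _ (by omega)) hjL, ?_, ?_⟩
  · have h3 := hT₂ T (by omega)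
    have h4 : (T + 1) * L ≤ 2 ^ T := by
      rw [pow_one] at h3; exact_mod_cast h3
    rw [mul_comm] at h4
    omega
  · have h3 : (1 : ℝ) / c ≤ 2 ^ T := hT₁.le.trans (by gcongr; norm_num; omega)
    have h4 : (2 : ℝ) ^ (T * (d + 2 * A)) * 2 ^ T * 2 ^ T ≤ 2 ^ j := by
      rw [← pow_add, ← pow_add]
      refine pow_le_pow_right₀ (by norm_num) (le_trans (le_of_eq ?_) hjL)
      rw [hL]; ring
    rw [div_le_iff₀ hc] at h3
    rw [div_mul_eq_mul_div, div_le_div_iff₀ (by positivity) (by positivity)]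
    have h5 : (0 : ℝ) < 2 ^ (T * (d + 2 * A)) * 2 ^ T := by positivity
    nlinarith [mul_le_mul_of_nonneg_right h4 hc.le]

lemma card_coprime_pairs_le (n m : ℕ) (hn : 0 < n) (hm : 0 < m) (hnm : n ≠ m) (η : ℝ)
    (hη : 0 ≤ η) (s : Finset (ℕ × ℕ))
    (hs : ∀ p ∈ s, p.1 < n ∧ p.2 < m ∧ n.Coprime p.1 ∧ m.Coprime p.2 ∧
      dn ((p.1 : ℝ) / n - (p.2 : ℝ) / m) < η) :
    (s.card : ℝ) ≤ 2 * η * n * m := by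
  have hn0 : (0 : ℝ) < n := by exact_mod_cast hn
  have hm0 : (0 : ℝ) < m := by exact_mod_cast hm
  obtain ⟨g, n', m', hg, hcop, hn', hm'⟩ := Nat.exists_coprime' (Nat.gcd_pos_of_pos_left m hn)
  have hn'0 : 0 < n' := Nat.pos_of_ne_zero fun h => by simp [h] at hn'; omega
  have hm'0 : 0 < m' := Nat.pos_of_ne_zero fun h => by simp [h] at hm'; omega
  have hg0 : (0 : ℝ) < g := by exact_mod_cast hg
  set z : ℕ × ℕ → ℤ := fun p => round ((p.1 : ℝ) / n - (p.2 : ℝ) / m) with hz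
  set k : ℕ × ℕ → ℤ := fun p => p.1 * m' - p.2 * n' - z p * (n' * m' * g) with hk
  set X : ℝ := η * n * m / g with hX
  have hX0 : 0 ≤ X := by positivity
  have hkdn : ∀ p : ℕ × ℕ, |(k p : ℝ)| = dn ((p.1 : ℝ) / n - (p.2 : ℝ) / m) * n * m / g := by
    intro p
    have h1 : (k p : ℝ) = ((p.1 : ℝ) / n - (p.2 : ℝ) / m - z p) * (n * m / g) := by
      have hn'R : (n : ℝ) = n' * g := by exact_mod_cast hn'
      have hm'R : (m : ℝ) = m' * g := by exact_mod_cast hm'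
      have : (0 : ℝ) < n' := by exact_mod_cast hn'0
      have : (0 : ℝ) < m' := by exact_mod_cast hm'0
      rw [hk, hn'R, hm'R]; push_cast; field_simp
    rw [h1, abs_mul, abs_of_pos (show (0 : ℝ) < n * m / g by positivity)]
    unfold dn; rw [hz]; ring
  set t : Finset ℤ := (Finset.Icc (-⌊X⌋) ⌊X⌋).erase 0 with ht
  have htcard : (t.card : ℝ) ≤ 2 * X := by
    have hfl : 0 ≤ ⌊X⌋ := Int.floor_nonneg.2 hX0
    have h1 : (t.card : ℤ) = 2 * ⌊X⌋ := by
      rw [ht, Finset.card_erase_of_mem (by simp [hfl]), Int.card_Icc]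
      omega
    have h2 : (t.card : ℝ) = 2 * ⌊X⌋ := by exact_mod_cast h1
    rw [h2]
    linarith [Int.floor_le X]
  have hmaps : ∀ p ∈ s, k p ∈ t := by
    intro p hp
    obtain ⟨h1, h2, h3, h4, h5⟩ := hs p hp
    rw [ht, Finset.mem_erase, Finset.mem_Icc, ← abs_le]
    constructor
    · intro h0
      have h6 : (p.1 : ℤ) * m - p.2 * n = z p * (n * m) := by
        have : (k p) * g = 0 := by rw [h0, zero_mul]
        rw [hk] at this
        have hn'Z : (n : ℤ) = n' * g := by exact_mod_cast hn'
        have hm'Z : (m : ℤ) = m' * g := by exact_mod_cast hm'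
        rw [hn'Z, hm'Z]; linear_combination this
      have h7 : (n : ℤ) ∣ p.1 * m := ⟨p.2 + z p * m, by linear_combination h6⟩
      have h8 : (m : ℤ) ∣ p.2 * n := ⟨p.1 - z p * n, by linear_combination -h6⟩
      have h9 : n ∣ m := h3.dvd_of_dvd_mul_left (by exact_mod_cast h7)
      have h10 : m ∣ n := h4.dvd_of_dvd_mul_left (by exact_mod_cast h8)
      exact hnm (Nat.dvd_antisymm h9 h10)
    · rw [Int.le_floor]
      push_cast
      rw [hkdn, hX]
      gcongr
  have hfib : ∀ b ∈ t, (s.filter fun p => k p = b).card ≤ g := by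
    intro b _
    rw [← Finset.card_range g]
    refine Finset.card_le_card_of_injOn (fun p => p.1 / n') ?_ ?_
    · intro p hp
      have hp' := (hs p (Finset.mem_filter.1 hp).1).1
      simp only [Finset.coe_range, Set.mem_Iio]
      rw [Nat.div_lt_iff_lt_mul hn'0, mul_comm, ← hn']
      exact hp'
    · intro p hp q hq hpq
      have hp1 := Finset.mem_filter.1 hp
      have hq1 := Finset.mem_filter.1 hq
      have hkk : k p = k q := hp1.2.trans hq1.2.symm
      rw [hk] at hkk
      simp only at hkk hpq
      have e1 : ((p.1 : ℤ) - q.1) * m' = n' * ((p.2 - q.2) + (z p - z q) * (m' * g)) := by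
        linear_combination hkk
      have e2 : (n' : ℤ) ∣ (p.1 : ℤ) - q.1 :=
        (Nat.isCoprime_iff_coprime.2 hcop).dvd_of_dvd_mul_right ⟨_, e1⟩
      have e3 : p.1 = q.1 := by
        have h1 : q.1 ≡ p.1 [MOD n'] := (Nat.modEq_iff_dvd).2 e2
        have h2 := Nat.div_add_mod p.1 n'
        have h3 := Nat.div_add_mod q.1 n'
        rw [hpq, ← (show q.1 % n' = p.1 % n' from h1)] at h2
        omega
      have e4 : (m : ℤ) ∣ (p.2 : ℤ) - q.2 := by
        have hm'Z : (m : ℤ) = m' * g := by exact_mod_cast hm'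
        refine ⟨-(z p - z q), ?_⟩
        have hne : (n' : ℤ) ≠ 0 := by exact_mod_cast hn'0.ne'
        apply mul_left_cancel₀ hne
        rw [e3, sub_self, zero_mul] at e1
        rw [hm'Z]; linear_combination -e1
      have e5 : p.2 = q.2 := by
        have h1 : q.2 ≡ p.2 [MOD m] := (Nat.modEq_iff_dvd).2 e4
        exact (Nat.ModEq.eq_of_lt_of_lt h1 (hs q hq1.1).2.1 (hs p hp1.1).2.1).symm
      exact Prod.ext e3 e5
  have h := Finset.card_le_mul_card_image_of_maps_to hmaps g hfib
  calc (s.card : ℝ) ≤ g * t.card := by exact_mod_cast h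
    _ ≤ g * (2 * X) := by gcongr
    _ = _ := by rw [hX]; field_simp

lemma eq_of_dn_sub_div_lt (n a b : ℕ) (hn : 0 < n) (ha : a < n) (hb : b < n)
    (h : dn ((a : ℝ) / n - (b : ℝ) / n) < 1 / n) : a = b := by
  have hn0 : (0 : ℝ) < n := by exact_mod_cast hn
  unfold dn at h
  set z := round ((a : ℝ) / n - (b : ℝ) / n)
  have h1 : |(((a : ℤ) - b - z * n : ℤ) : ℝ)| < 1 := by
    have : (((a : ℤ) - b - z * n : ℤ) : ℝ) = ((a : ℝ) / n - (b : ℝ) / n - z) * n := by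
      push_cast; field_simp
    rw [this, abs_mul, abs_of_pos hn0]
    rwa [lt_div_iff₀ hn0] at h
  have h2 : (a : ℤ) - b - z * n = 0 := by
    rw [← Int.abs_lt_one_iff]; exact_mod_cast h1
  have h3 : b ≡ a [MOD n] := (Nat.modEq_iff_dvd).2 ⟨z, by linear_combination h2⟩
  exact (Nat.ModEq.eq_of_lt_of_lt h3 hb ha).symm

lemma sq_sum_measure_le {Ω ι : Type*} [MeasurableSpace Ω] (μ : Measure Ω) [IsFiniteMeasure μ]
    (P : Finset ι) (B : ι → Set Ω) (hB : ∀ i, MeasurableSet (B i)) :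
    (∑ i ∈ P, μ.real (B i)) ^ 2 ≤
      μ.real (⋃ i ∈ P, B i) * ∑ i ∈ P, ∑ j ∈ P, μ.real (B i ∩ B j) := by
  set U := ⋃ i ∈ P, B i with hU
  have hUm : MeasurableSet U := Finset.measurableSet_biUnion _ fun i _ => hB i
  have hindic : ∀ s : Set Ω, MeasurableSet s → Integrable (s.indicator (1 : Ω → ℝ)) μ :=
    fun s hs => (integrable_const (1 : ℝ)).indicator hs
  have key : ∀ t : ℝ, 0 ≤ μ.real U * (t * t) + (-(2 * ∑ i ∈ P, μ.real (B i))) * t +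
      ∑ i ∈ P, ∑ j ∈ P, μ.real (B i ∩ B j) := by
    intro t
    have h1 : 0 ≤ ∫ x, ((t * t) * U.indicator (1 : Ω → ℝ) x -
        (2 * t) * ∑ i ∈ P, (B i).indicator (1 : Ω → ℝ) x +
        ∑ i ∈ P, ∑ j ∈ P, (B i ∩ B j).indicator (1 : Ω → ℝ) x) ∂μ := by
      refine integral_nonneg fun x => ?_
      simp only [Pi.zero_apply, Set.inter_indicator_one, Pi.mul_apply]
      rw [← Finset.sum_mul_sum]
      by_cases hx : x ∈ U
      · rw [Set.indicator_of_mem hx, Pi.one_apply]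
        nlinarith [sq_nonneg (t - ∑ i ∈ P, (B i).indicator (1 : Ω → ℝ) x)]
      · have : ∑ i ∈ P, (B i).indicator (1 : Ω → ℝ) x = 0 :=
          Finset.sum_eq_zero fun i hi => Set.indicator_of_notMem (fun h => hx (by
            rw [hU]; exact Set.mem_biUnion hi h)) _
        rw [Set.indicator_of_notMem hx, this]; simp
    rw [integral_add, integral_sub, integral_const_mul, integral_const_mul, integral_finsetSum,
      integral_finsetSum] at h1
    · have h2 : ∀ i ∈ P, ∫ x, ∑ j ∈ P, (B i ∩ B j).indicator (1 : Ω → ℝ) x ∂μ =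
          ∑ j ∈ P, μ.real (B i ∩ B j) := by
        intro i _
        rw [integral_finsetSum _ fun j _ => hindic _ ((hB i).inter (hB j))]
        exact Finset.sum_congr rfl fun j _ => integral_indicator_one ((hB i).inter (hB j))
      rw [Finset.sum_congr rfl h2, integral_indicator_one hUm,
        Finset.sum_congr rfl fun i _ => integral_indicator_one (hB i)] at h1
      linarith
    · exact fun i _ => integrable_finsetSum _ fun j _ => hindic _ ((hB i).inter (hB j))
    · exact fun i _ => hindic _ (hB i)
    · exact (hindic _ hUm).const_mul _
    · exact (integrable_finsetSum _ fun i _ => hindic _ (hB i)).const_mul _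
    · exact ((hindic _ hUm).const_mul _).sub
        ((integrable_finsetSum _ fun i _ => hindic _ (hB i)).const_mul _)
    · exact integrable_finsetSum _ fun i _ => integrable_finsetSum _ fun j _ =>
        hindic _ ((hB i).inter (hB j))
  have := discrim_le_zero key
  unfold discrim at this
  nlinarith

lemma volume_real_ball_le (x : UnitAddCircle) (δ : ℝ) (hδ : 0 ≤ δ) :
    volume.real (Metric.ball x δ) ≤ 2 * δ := by
  refine (measureReal_mono Metric.ball_subset_closedBall).trans ?_
  rw [Measure.real, AddCircle.volume_closedBall, ENNReal.toReal_ofReal (by positivity)]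
  exact min_le_right _ _

lemma volume_real_ball (x : UnitAddCircle) (δ : ℝ) (hδ : 0 ≤ δ) (hδ1 : 2 * δ ≤ 1) :
    volume.real (Metric.ball x δ) = 2 * δ := by
  rw [← measureReal_congr AddCircle.closedBall_ae_eq_ball, Measure.real,
    AddCircle.volume_closedBall, ENNReal.toReal_ofReal (by positivity), min_eq_right hδ1]

/-- The numerators of the reduced fractions with denominator `n`. -/
def reducedNumerators (n : ℕ) : Finset ℕ := (Finset.range n).filter n.Coprime

lemma card_reducedNumerators (n : ℕ) : (reducedNumerators n).card = n.totient := rfl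

/-- The ball of radius `δ` about `a / n` in the circle. -/
def fracBall (n a : ℕ) (δ : ℝ) : Set UnitAddCircle :=
  Metric.ball (((a : ℝ) / n : ℝ) : UnitAddCircle) δ

lemma dn_lt_of_fracBall_inter_ne_zero (n m a b : ℕ) (δ ε : ℝ)
    (h : volume.real (fracBall n a δ ∩ fracBall m b ε) ≠ 0) :
    dn ((a : ℝ) / n - (b : ℝ) / m) < δ + ε := by
  obtain ⟨x, hx, hy⟩ : (fracBall n a δ ∩ fracBall m b ε).Nonempty := by
    rw [Set.nonempty_iff_ne_empty]; rintro h0; simp [h0] at h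
  rw [dn_eq_norm, AddCircle.coe_sub, ← dist_eq_norm]
  have := dist_triangle_left (((a : ℝ) / n : ℝ) : UnitAddCircle) (((b : ℝ) / m : ℝ)) x
  have h1 : dist x _ < δ := hx
  have h2 : dist x _ < ε := hy
  linarith

lemma sum_fracBall_inter_le_of_ne (n m : ℕ) (hn : 0 < n) (hm : 0 < m) (hnm : n ≠ m) (δ ε : ℝ)
    (hδ : 0 ≤ δ) (hε : 0 ≤ ε) :
    ∑ a ∈ reducedNumerators n, ∑ b ∈ reducedNumerators m,
      volume.real (fracBall n a δ ∩ fracBall m b ε) ≤ 8 * (n * δ) * (m * ε) := by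
  classical
  rw [← Finset.sum_product']
  set s := (reducedNumerators n ×ˢ reducedNumerators m).filter fun p =>
    volume.real (fracBall n p.1 δ ∩ fracBall m p.2 ε) ≠ 0 with hs
  have hcard := card_coprime_pairs_le n m hn hm hnm (δ + ε) (by positivity) s (by
    intro p hp
    simp only [hs, reducedNumerators, Finset.mem_filter, Finset.mem_product, Finset.mem_range] at hp
    exact ⟨hp.1.1.1, hp.1.2.1, hp.1.1.2, hp.1.2.2,
      dn_lt_of_fracBall_inter_ne_zero _ _ _ _ _ _ hp.2⟩)
  rw [← Finset.sum_filter_ne_zero]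
  have hmin : (δ + ε) * min δ ε ≤ 2 * (δ * ε) := by
    rcases le_total δ ε with h | h
    · rw [min_eq_left h]; nlinarith
    · rw [min_eq_right h]; nlinarith
  have hmin0 : 0 ≤ min δ ε := le_min hδ hε
  calc _ ≤ ∑ p ∈ s, 2 * min δ ε := by
        refine Finset.sum_le_sum fun p _ => ?_
        rw [mul_min_of_nonneg _ _ (by norm_num : (0 : ℝ) ≤ 2)]
        exact le_min ((measureReal_mono Set.inter_subset_left).trans (volume_real_ball_le _ _ hδ))
          ((measureReal_mono Set.inter_subset_right).trans (volume_real_ball_le _ _ hε))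
    _ = s.card * (2 * min δ ε) := by rw [Finset.sum_const, nsmul_eq_mul]
    _ ≤ (2 * (δ + ε) * n * m) * (2 * min δ ε) := by gcongr
    _ = 4 * n * m * ((δ + ε) * min δ ε) := by ring
    _ ≤ 4 * n * m * (2 * (δ * ε)) := by gcongr
    _ = _ := by ring

lemma sum_fracBall_inter_self_le (n : ℕ) (hn : 0 < n) (δ : ℝ) (hδ : 0 ≤ δ)
    (hδn : 2 * (n * δ) ≤ 1) :
    ∑ a ∈ reducedNumerators n, ∑ b ∈ reducedNumerators n,
      volume.real (fracBall n a δ ∩ fracBall n b δ) ≤ 2 * (n * δ) := by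
  have hn0 : (0 : ℝ) < n := by exact_mod_cast hn
  have h : ∀ a ∈ reducedNumerators n, ∑ b ∈ reducedNumerators n,
      volume.real (fracBall n a δ ∩ fracBall n b δ) ≤ 2 * δ := by
    intro a ha
    rw [Finset.sum_eq_single_of_mem a ha]
    · exact (measureReal_mono Set.inter_subset_left).trans (volume_real_ball_le _ _ hδ)
    · intro b hb hba
      by_contra h0
      refine hba (eq_of_dn_sub_div_lt n a b hn ?_ ?_ ?_).symm
      · exact Finset.mem_range.1 (Finset.mem_filter.1 ha).1
      · exact Finset.mem_range.1 (Finset.mem_filter.1 hb).1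
      · refine (dn_lt_of_fracBall_inter_ne_zero _ _ _ _ _ _ h0).trans_le ?_
        rw [le_div_iff₀ hn0]; linarith
  refine (Finset.sum_le_sum h).trans ?_
  rw [Finset.sum_const, nsmul_eq_mul, card_reducedNumerators]
  have : (n.totient : ℝ) ≤ n := by exact_mod_cast Nat.totient_le n
  nlinarith

/-- A second moment lower bound for the measure of a finite union of neighbourhoods of reduced
fractions. -/
lemma le_volume_real_iUnion_fracBall (S : Finset ℕ) (Ψ : ℕ → ℝ) (κ : ℝ) (hκ : 0 ≤ κ)
    (hS : ∀ n ∈ S, 0 < n) (hΨ0 : ∀ n ∈ S, 0 ≤ Ψ n) (hΨ1 : ∀ n ∈ S, Ψ n ≤ 1 / 2)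
    (h1 : 1 ≤ ∑ n ∈ S, Ψ n)
    (hφ : κ * ∑ n ∈ S, Ψ n ≤ ∑ n ∈ S, Ψ n * ((n.totient : ℝ) / n)) :
    2 * κ ^ 2 / 5 ≤ volume.real (⋃ n ∈ S, ⋃ a ∈ reducedNumerators n, fracBall n a (Ψ n / n)) := by
  classical
  set P := S.sigma reducedNumerators with hP
  set B : (Σ _ : ℕ, ℕ) → Set UnitAddCircle := fun p => fracBall p.1 p.2 (Ψ p.1 / p.1) with hB
  have hU : (⋃ n ∈ S, ⋃ a ∈ reducedNumerators n, fracBall n a (Ψ n / n)) = ⋃ p ∈ P, B p := by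
    ext x; simp [hP, hB, Finset.mem_sigma, and_assoc]
  rw [hU]
  have hsm := sq_sum_measure_le volume P B fun p => (Metric.isOpen_ball).measurableSet
  set Y := ∑ n ∈ S, Ψ n with hY
  have hfirst : ∑ p ∈ P, volume.real (B p) = 2 * ∑ n ∈ S, Ψ n * ((n.totient : ℝ) / n) := by
    rw [hP, Finset.sum_sigma, Finset.mul_sum]
    refine Finset.sum_congr rfl fun n hn => ?_
    have hn0 : (1 : ℝ) ≤ n := by exact_mod_cast hS n hn
    have : ∀ a ∈ reducedNumerators n, volume.real (B ⟨n, a⟩) = 2 * (Ψ n / n) := fun a _ => by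
      refine volume_real_ball _ _ (div_nonneg (hΨ0 n hn) (by linarith)) ?_
      have := div_le_self (hΨ0 n hn) hn0
      linarith [hΨ1 n hn]
    rw [Finset.sum_congr rfl this, Finset.sum_const, nsmul_eq_mul, card_reducedNumerators]
    ring
  have hpair : ∑ p ∈ P, ∑ q ∈ P, volume.real (B p ∩ B q) ≤ 2 * Y + 8 * Y ^ 2 := by
    have e1 : ∑ p ∈ P, ∑ q ∈ P, volume.real (B p ∩ B q) = ∑ n ∈ S, ∑ m ∈ S,
        ∑ a ∈ reducedNumerators n, ∑ b ∈ reducedNumerators m,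
          volume.real (fracBall n a (Ψ n / n) ∩ fracBall m b (Ψ m / m)) := by
      rw [hP, Finset.sum_sigma]
      refine Finset.sum_congr rfl fun n _ => ?_
      rw [Finset.sum_comm (s := S)]
      exact Finset.sum_congr rfl fun a _ => Finset.sum_sigma _ _ _
    have e2 : ∀ n ∈ S, ∀ m ∈ S, ∑ a ∈ reducedNumerators n, ∑ b ∈ reducedNumerators m,
          volume.real (fracBall n a (Ψ n / n) ∩ fracBall m b (Ψ m / m)) ≤
          (if n = m then 2 * Ψ n else 0) + 8 * (Ψ n * Ψ m) := by
      intro n hn m hm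
      have hn0 : (0 : ℝ) < n := by exact_mod_cast hS n hn
      have hm0 : (0 : ℝ) < m := by exact_mod_cast hS m hm
      have hcn : (n : ℝ) * (Ψ n / n) = Ψ n := mul_div_cancel₀ _ hn0.ne'
      have hcm : (m : ℝ) * (Ψ m / m) = Ψ m := mul_div_cancel₀ _ hm0.ne'
      split_ifs with h
      · subst h
        have := sum_fracBall_inter_self_le n (hS n hn) (Ψ n / n) (div_nonneg (hΨ0 n hn) hn0.le)
          (by rw [hcn]; linarith [hΨ1 n hn])
        rw [hcn] at this
        nlinarith [mul_self_nonneg (Ψ n)]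
      · have := sum_fracBall_inter_le_of_ne n m (hS n hn) (hS m hm) h (Ψ n / n) (Ψ m / m)
          (div_nonneg (hΨ0 n hn) hn0.le) (div_nonneg (hΨ0 m hm) hm0.le)
        rw [hcn, hcm] at this
        linarith
    rw [e1]
    refine (Finset.sum_le_sum fun n hn => Finset.sum_le_sum fun m hm => e2 n hn m hm).trans ?_
    have e3 : ∀ n ∈ S, ∑ m ∈ S, ((if n = m then 2 * Ψ n else 0) + 8 * (Ψ n * Ψ m)) =
        2 * Ψ n + 8 * Y * Ψ n := by
      intro n hn
      rw [Finset.sum_add_distrib, Finset.sum_ite_eq, if_pos hn, ← Finset.mul_sum, ← Finset.mul_sum]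
      ring
    rw [Finset.sum_congr rfl e3, Finset.sum_add_distrib, ← Finset.mul_sum, ← Finset.mul_sum]
    exact le_of_eq (by ring)
  rw [hfirst] at hsm
  set M := volume.real (⋃ p ∈ P, B p)
  have hM : 0 ≤ M := measureReal_nonneg
  have h2 : (2 * (κ * Y)) ^ 2 ≤ M * (10 * Y ^ 2) := by
    calc _ ≤ (2 * ∑ n ∈ S, Ψ n * ((n.totient : ℝ) / n)) ^ 2 := by gcongr
      _ ≤ _ := hsm
      _ ≤ M * (2 * Y + 8 * Y ^ 2) := by gcongr
      _ ≤ M * (10 * Y ^ 2) := by gcongr; nlinarith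
  have hY2 : 0 < Y ^ 2 := by positivity
  have h3 : 2 * κ ^ 2 / 5 * (10 * Y ^ 2) ≤ M * (10 * Y ^ 2) := by nlinarith
  exact le_of_mul_le_mul_right h3 (by positivity)

/-- If the second moment bound applies to finite sets of arbitrarily large denominators, then
Gallagher's zero-one law shows that almost every point of the circle is well approximable. -/
lemma ae_mem_addWellApproximable (Ψ : ℕ → ℝ) (κ : ℝ) (hκ : 0 < κ) (hΨ0 : ∀ n, 0 ≤ Ψ n)
    (hΨ1 : ∀ n, Ψ n ≤ 1 / 2)
    (h : ∀ N : ℕ, ∃ S : Finset ℕ, (∀ n ∈ S, N < n) ∧ 1 ≤ ∑ n ∈ S, Ψ n ∧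
      κ * ∑ n ∈ S, Ψ n ≤ ∑ n ∈ S, Ψ n * ((n.totient : ℝ) / n)) :
    ∀ᵐ x : UnitAddCircle, x ∈ addWellApproximable UnitAddCircle fun n => Ψ n / n := by
  have hlim : Tendsto (fun n : ℕ => Ψ n / n) atTop (nhds 0) := by
    refine squeeze_zero (fun n => div_nonneg (hΨ0 n) n.cast_nonneg)
      (fun n => div_le_div_of_nonneg_right (hΨ1 n) n.cast_nonneg) ?_
    exact tendsto_const_div_atTop_nhds_zero_nat _
  refine (AddCircle.addWellApproximable_ae_empty_or_univ _ hlim).resolve_left fun hnot => ?_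
  set U : ℕ → Set UnitAddCircle := fun N =>
    ⋃ n ∈ Set.Ioi N, ⋃ a ∈ reducedNumerators n, fracBall n a (Ψ n / n) with hU
  have hUanti : Antitone U := fun N M hNM =>
    Set.biUnion_subset_biUnion_left (Set.Ioi_subset_Ioi hNM)
  have hUm : ∀ N, MeasurableSet (U N) := fun N =>
    (isOpen_biUnion fun _ _ => isOpen_biUnion fun _ _ => Metric.isOpen_ball).measurableSet
  have hUle : ∀ N, ENNReal.ofReal (2 * κ ^ 2 / 5) ≤ volume (U N) := by
    intro N
    obtain ⟨S, hS, h1, hφ⟩ := h N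
    have hle := le_volume_real_iUnion_fracBall S Ψ κ hκ.le (fun n hn => (hS n hn).pos)
      (fun n _ => hΨ0 n) (fun n _ => hΨ1 n) h1 hφ
    refine ENNReal.ofReal_le_of_le_toReal (hle.trans ?_)
    exact measureReal_mono (Set.biUnion_subset_biUnion_left fun n hn => hS n hn)
      (measure_ne_top volume _)
  have hI : volume (⋂ N, U N) = 0 := by
    refine measure_mono_null ?_ hnot
    intro x hx
    simp only [Set.mem_compl_iff, Set.mem_ofPred_eq, not_not]
    rw [UnitAddCircle.mem_addWellApproximable_iff]
    refine Set.infinite_of_not_bddAbove ?_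
    rintro ⟨N, hN⟩
    have hxN := Set.mem_iInter.1 hx N
    simp only [hU, Set.mem_iUnion, Set.mem_Ioi, exists_prop] at hxN
    obtain ⟨n, hn, a, ha, hxa⟩ := hxN
    refine absurd (hN (show n ∈ _ from ⟨a, ?_, ?_, ?_⟩)) (not_le.2 hn)
    · exact Finset.mem_range.1 (Finset.mem_filter.1 ha).1
    · exact (Nat.coprime_comm.1 (Finset.mem_filter.1 ha).2)
    · rw [← dist_eq_norm]; exact hxa
  have ht := tendsto_measure_iInter_atTop (μ := (volume : Measure UnitAddCircle))
    (fun N => (hUm N).nullMeasurableSet) hUanti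
    ⟨0, measure_ne_top _ _⟩
  rw [hI] at ht
  have := ge_of_tendsto' ht hUle
  simp only [nonpos_iff_eq_zero, ENNReal.ofReal_eq_zero] at this
  have : 0 < κ ^ 2 := by positivity
  linarith

lemma sum_Ico_two_pow (f : ℕ → ℝ) (a M : ℕ) :
    ∑ n ∈ Finset.Ico (2 ^ a) (2 ^ (a + M)), f n =
      ∑ i ∈ Finset.range M, ∑ n ∈ Finset.Ico (2 ^ (i + a)) (2 ^ (i + a + 1)), f n := by
  induction M with
  | zero => simp
  | succ M ih =>
    rw [Finset.sum_range_succ, ← ih, add_comm M a, ← add_assoc]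
    exact (Finset.sum_Ico_consecutive _ (Nat.pow_le_pow_right two_pos (by omega))
      (Nat.pow_le_pow_right two_pos (by omega))).symm

/-- Cauchy condensation for `∑ ψ n * log n ^ d`. -/
lemma not_summable_condensed (ψ : ℕ → ℝ) (hψ0 : ∀ n, 0 ≤ ψ n) (hψ : Antitone ψ) (d : ℕ)
    (hdiv : ¬ Summable fun n : ℕ => ψ n * Real.log n ^ d) :
    ¬ Summable fun j : ℕ => (2 : ℝ) ^ j * ψ (2 ^ j) * ((j : ℝ) + 1) ^ d := by
  intro hs
  refine hdiv ?_
  have hf0 : ∀ n : ℕ, 0 ≤ ψ n * Real.log n ^ d := fun n =>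
    mul_nonneg (hψ0 n) (pow_nonneg (Real.log_natCast_nonneg n) d)
  refine summable_of_sum_range_le hf0
    (c := ψ 0 * Real.log (0 : ℕ) ^ d + ∑' j : ℕ, (2 : ℝ) ^ j * ψ (2 ^ j) * ((j : ℝ) + 1) ^ d) ?_
  intro N
  have hN : Finset.range N ⊆ Finset.range (2 ^ N) := Finset.range_mono Nat.lt_two_pow_self.le
  refine (Finset.sum_le_sum_of_subset_of_nonneg hN fun n _ _ => hf0 n).trans ?_
  rw [Finset.range_eq_Ico, Finset.sum_eq_sum_Ico_succ_bot (by positivity)]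
  gcongr
  have h1 := sum_Ico_two_pow (fun n => ψ n * Real.log n ^ d) 0 N
  simp only [pow_zero, zero_add, add_zero] at h1 ⊢
  rw [h1]
  refine le_trans ?_ (hs.sum_le_tsum (Finset.range N) fun j _ =>
    mul_nonneg (mul_nonneg (by positivity) (hψ0 _)) (by positivity))
  refine Finset.sum_le_sum fun j _ => ?_
  have h2 : ∀ n ∈ Finset.Ico (2 ^ j) (2 ^ (j + 1)),
      ψ n * Real.log n ^ d ≤ ψ (2 ^ j) * ((j : ℝ) + 1) ^ d := by
    intro n hn
    rw [Finset.mem_Ico] at hn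
    have hn0 : (0 : ℝ) < n := by exact_mod_cast (pow_pos two_pos j).trans_le hn.1
    have hlog : Real.log n ≤ j + 1 := by
      have h3 : Real.log n ≤ Real.log ((2 : ℝ) ^ (j + 1)) :=
        Real.log_le_log hn0 (by exact_mod_cast hn.2.le)
      rw [Real.log_pow] at h3
      push_cast at h3
      nlinarith [Real.log_two_lt_d9, (j.cast_nonneg : (0 : ℝ) ≤ j)]
    exact mul_le_mul (hψ hn.1) (pow_le_pow_left₀ (Real.log_natCast_nonneg n) hlog d)
      (pow_nonneg (Real.log_natCast_nonneg n) d) (hψ0 _)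
  refine (Finset.sum_le_sum h2).trans (le_of_eq ?_)
  rw [Finset.sum_const, Nat.card_Ico, nsmul_eq_mul, pow_succ, mul_two, Nat.add_sub_cancel]
  push_cast; ring

/-- The condensed series still diverges after truncation. -/
lemma not_summable_truncated (ψ : ℕ → ℝ) (hψ0 : ∀ n, 0 ≤ ψ n) (hψ : Antitone ψ) (d : ℕ)
    (hdiv : ¬ Summable fun n : ℕ => ψ n * Real.log n ^ d) :
    ¬ Summable fun j : ℕ => min (ψ (2 ^ (j + 1))) ((2 : ℝ) ^ j)⁻¹ * 2 ^ j * (j : ℝ) ^ d := by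
  intro hs
  refine not_summable_condensed ψ hψ0 hψ d hdiv ?_
  rw [← summable_nat_add_iff 1]
  have hlt : ∀ᶠ j : ℕ in atTop,
      min (ψ (2 ^ (j + 1))) ((2 : ℝ) ^ j)⁻¹ * 2 ^ j * (j : ℝ) ^ d < 1 :=
    hs.tendsto_atTop_zero.eventually (gt_mem_nhds one_pos)
  refine Summable.of_norm_bounded_eventually_nat (hs.mul_left (2 * 3 ^ d)) ?_
  filter_upwards [hlt, eventually_ge_atTop 1] with j hj hj1
  have hj1' : (1 : ℝ) ≤ j := by exact_mod_cast hj1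
  have hθ : min (ψ (2 ^ (j + 1))) ((2 : ℝ) ^ j)⁻¹ = ψ (2 ^ (j + 1)) := by
    refine min_eq_left (not_lt.1 fun h => ?_)
    rw [min_eq_right h.le, inv_mul_cancel₀ (by positivity), one_mul] at hj
    exact absurd hj (not_lt.2 (one_le_pow₀ hj1'))
  have hnn : 0 ≤ (2 : ℝ) ^ (j + 1) * ψ (2 ^ (j + 1)) * (((j + 1 : ℕ) : ℝ) + 1) ^ d :=
    mul_nonneg (mul_nonneg (by positivity) (hψ0 _)) (by positivity)
  rw [Real.norm_of_nonneg hnn, hθ]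
  have h3 : (((j + 1 : ℕ) : ℝ) + 1) ^ d ≤ (3 * j) ^ d := by
    refine pow_le_pow_left₀ (by positivity) ?_ d
    push_cast; linarith
  calc _ ≤ (2 : ℝ) ^ (j + 1) * ψ (2 ^ (j + 1)) * (3 * j) ^ d := by
        exact mul_le_mul_of_nonneg_left h3 (mul_nonneg (by positivity) (hψ0 _))
    _ = _ := by rw [mul_pow]; ring

lemma exists_one_le_sum_range (B : ℕ → ℝ) (hB : ∀ j, 0 ≤ B j) (h : ¬ Summable B) (a : ℕ) :
    ∃ M, 1 ≤ ∑ i ∈ Finset.range M, B (i + a) := by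
  by_contra! hlt
  exact h ((summable_nat_add_iff a).1
    (summable_of_sum_range_le (fun i => hB _) fun M => (hlt M).le))

/-- The approximating function attached to `ψ`: a truncation of `ψ`, constant on dyadic blocks,
weighted by `prodWeight` at a scale proportional to the block index. -/
noncomputable def weightedRadius {d : ℕ} (ψ : ℕ → ℝ) (L J : ℕ) (α γ : Fin d → ℝ) (n : ℕ) : ℝ :=
  if J ≤ Nat.log 2 n then
    min (ψ (2 ^ (Nat.log 2 n + 1))) ((2 : ℝ) ^ Nat.log 2 n)⁻¹ / 2 ^ d *
      prodWeight (Nat.log 2 n / L) α γ n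
  else 0

section WeightedRadius

variable {d : ℕ} {ψ : ℕ → ℝ} {L J : ℕ} {α γ : Fin d → ℝ}

lemma weightedRadius_nonneg (hψ0 : ∀ n, 0 ≤ ψ n) (n : ℕ) : 0 ≤ weightedRadius ψ L J α γ n := by
  unfold weightedRadius
  split_ifs
  · exact mul_nonneg (div_nonneg (le_min (hψ0 _) (by positivity)) (by positivity))
      (prodWeight_nonneg _ _ _ _)
  · exact le_rfl

lemma weightedRadius_le_half (hψ0 : ∀ n, 0 ≤ ψ n)
    (hLJ : ∀ j, J ≤ j → 0 < j / L ∧ (j / L) * (d + 1) ≤ j) (n : ℕ) :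
    weightedRadius ψ L J α γ n ≤ 1 / 2 := by
  unfold weightedRadius
  split_ifs with h
  · obtain ⟨h1, h2⟩ := hLJ _ h
    set j := Nat.log 2 n
    set T := j / L
    have hW := prodWeight_le T α γ n
    have hθ : min (ψ (2 ^ (j + 1))) ((2 : ℝ) ^ j)⁻¹ / 2 ^ d ≤ ((2 : ℝ) ^ j)⁻¹ :=
      (div_le_self (le_min (hψ0 _) (by positivity)) (one_le_pow₀ one_le_two)).trans
        (min_le_right _ _)
    calc _ ≤ ((2 : ℝ) ^ j)⁻¹ * (2 ^ T) ^ d :=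
          mul_le_mul hθ hW (prodWeight_nonneg _ _ _ _) (by positivity)
      _ ≤ 1 / 2 := by
        rw [inv_mul_le_iff₀ (by positivity), ← pow_mul]
        have : (2 : ℝ) ^ (T * d + 1) ≤ 2 ^ j := by
          refine pow_le_pow_right₀ one_le_two ?_
          rw [mul_add, mul_one] at h2; omega
        rw [pow_succ] at this; linarith
  · norm_num

lemma weightedRadius_eq_of_mem_Ico {j n : ℕ} (hj : J ≤ j)
    (hn : n ∈ Finset.Ico (2 ^ j) (2 ^ (j + 1))) :
    weightedRadius ψ L J α γ n =
      min (ψ (2 ^ (j + 1))) ((2 : ℝ) ^ j)⁻¹ / 2 ^ d * prodWeight (j / L) α γ n := by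
  rw [Finset.mem_Ico] at hn
  have : Nat.log 2 n = j := Nat.log_eq_of_pow_le_of_lt_pow hn.1 hn.2
  rw [weightedRadius, this, if_pos hj]

lemma mul_dn_lt_of_dn_lt_weightedRadius (hψ : Antitone ψ) (hψ0 : ∀ n, 0 ≤ ψ n) (n : ℕ) (x : ℝ)
    (h : dn x < weightedRadius ψ L J α γ n) :
    (∏ i, dn (n * α i - γ i)) * dn x < ψ n := by
  have hdx := dn_nonneg x
  unfold weightedRadius at h
  split_ifs at h with hJ
  · set j := Nat.log 2 n
    set θ := min (ψ (2 ^ (j + 1))) ((2 : ℝ) ^ j)⁻¹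
    have hW := prodWeight_mul_prod_dn_le (j / L) α γ n
    have hθψ : θ ≤ ψ n := (min_le_left _ _).trans (hψ (Nat.lt_pow_succ_log_self one_lt_two n).le)
    have hθ0 : 0 ≤ θ := le_min (hψ0 _) (by positivity)
    have hθ : 0 < θ := by
      refine lt_of_le_of_ne hθ0 fun h0 => ?_
      rw [← h0, zero_div, zero_mul] at h
      linarith
    have hp : 0 ≤ ∏ i, dn (n * α i - γ i) := Finset.prod_nonneg fun i _ => dn_nonneg _
    rcases hp.eq_or_lt with h0 | h0
    · rw [← h0, zero_mul]; exact hθ.trans_le hθψ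
    · calc _ < (∏ i, dn (n * α i - γ i)) * (θ / 2 ^ d * prodWeight (j / L) α γ n) :=
            mul_lt_mul_of_pos_left h h0
        _ = θ / 2 ^ d * (prodWeight (j / L) α γ n * ∏ i, dn (n * α i - γ i)) := by ring
        _ ≤ θ / 2 ^ d * 2 ^ d := by gcongr
        _ = θ := div_mul_cancel₀ _ (by positivity)
        _ ≤ ψ n := hθψ
  · linarith

end WeightedRadius

lemma ae_of_ae_unitAddCircle (p : UnitAddCircle → Prop) (h : ∀ᵐ x : UnitAddCircle, p x) :
    ∀ᵐ a : ℝ, p (a : UnitAddCircle) := by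
  have h1 : ∀ t : ℤ, ∀ᵐ a : ℝ ∂(volume.restrict (Set.Ioc (t : ℝ) (t + 1))),
      p (a : UnitAddCircle) := fun t =>
    (UnitAddCircle.measurePreserving_mk t).quasiMeasurePreserving.ae h
  have h2 := (ae_restrict_iUnion_iff (μ := (volume : Measure ℝ))
    (fun t : ℤ => Set.Ioc (t : ℝ) (t + 1)) fun a => p (a : UnitAddCircle)).2 h1
  rwa [iUnion_Ioc_intCast, Measure.restrict_univ] at h2

lemma ae_infinite_of_dual_lower_bound {d : ℕ} (α γ : Fin d → ℝ) (A : ℕ) (c : ℝ) (hc : 0 < c)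
    (hdual : ∀ (R : ℕ) (m : Fin d → ℤ), m ≠ 0 → (∀ i, |m i| ≤ R) →
      c / (R : ℝ) ^ A ≤ dn (∑ i, m i * α i))
    (ψ : ℕ → ℝ) (hψ0 : ∀ n, 0 ≤ ψ n) (hψ : Antitone ψ)
    (hdiv : ¬ Summable fun n : ℕ => ψ n * Real.log n ^ d) :
    ∀ᵐ a : ℝ, {n : ℕ | 0 < n ∧ (∏ i, dn (n * α i - γ i)) * dn (n * a) < ψ n}.Infinite := by
  obtain ⟨L, J, hL, hLJ⟩ := exists_block_scale d A c hc
  set Ψ := weightedRadius ψ L J α γ with hΨ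
  have hΨ0 : ∀ n, 0 ≤ Ψ n := weightedRadius_nonneg hψ0
  set I : ℕ → Finset ℕ := fun j => Finset.Ico (2 ^ j) (2 ^ (j + 1)) with hI
  set θ : ℕ → ℝ := fun j => min (ψ (2 ^ (j + 1))) ((2 : ℝ) ^ j)⁻¹ with hθ
  have hθ0 : ∀ j, 0 ≤ θ j := fun j => le_min (hψ0 _) (by positivity)
  have hblock : ∀ j, J ≤ j → ∀ w : ℕ → ℝ, ∑ n ∈ I j, Ψ n * w n =
      θ j / 2 ^ d * ∑ n ∈ I j, prodWeight (j / L) α γ n * w n := by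
    intro j hj w
    rw [Finset.mul_sum]
    refine Finset.sum_congr rfl fun n hn => ?_
    rw [hΨ, weightedRadius_eq_of_mem_Ico hj hn, mul_assoc]
  have hblock1 : ∀ j, J ≤ j → ∑ n ∈ I j, Ψ n =
      θ j / 2 ^ d * ∑ n ∈ I j, prodWeight (j / L) α γ n := fun j hj => by
    simpa using hblock j hj fun _ => 1
  have hdivB : ¬ Summable fun j => ∑ n ∈ I j, Ψ n := by
    intro hs
    refine not_summable_truncated ψ hψ0 hψ d hdiv ?_
    refine Summable.of_norm_bounded_eventually_nat
      (hs.mul_left ((2 * (L : ℝ)) ^ d * 2 ^ (d + 1))) ?_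
    filter_upwards [eventually_ge_atTop J] with j hj
    obtain ⟨h1, -, -, -, hE⟩ := hLJ j hj
    have hsum := le_sum_prodWeight (γ := γ) hc hdual j (j / L) h1 hE
    have hjL : (j : ℝ) ≤ 2 * L * (j / L : ℕ) := by
      have : j < L * (j / L) + L := Nat.lt_mul_div_succ j hL |>.trans_eq (by ring)
      have : j ≤ 2 * L * (j / L) := by nlinarith
      exact_mod_cast this
    have hjd : (j : ℝ) ^ d ≤ (2 * (L : ℝ)) ^ d * ((j / L : ℕ) : ℝ) ^ d := by
      rw [← mul_pow]; gcongr
    have hnn : 0 ≤ θ j * 2 ^ j * (j : ℝ) ^ d := by have := hθ0 j; positivity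
    rw [Real.norm_of_nonneg hnn, hblock1 j hj]
    have := hθ0 j
    calc _ ≤ θ j * 2 ^ j * ((2 * L) ^ d * ((j / L : ℕ) : ℝ) ^ d) := by gcongr
      _ = (2 * L) ^ d * 2 ^ (d + 1) *
          (θ j / 2 ^ d * (((j / L : ℕ) : ℝ) ^ d * 2 ^ j / 2)) := by
        rw [pow_succ]; field_simp
      _ ≤ _ := by gcongr
  have hae := ae_mem_addWellApproximable Ψ (Real.exp (-(2 * 9))) (Real.exp_pos _) hΨ0
    (weightedRadius_le_half hψ0 fun j hj => ⟨(hLJ j hj).1, (hLJ j hj).2.2.1⟩) (by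
      intro N
      obtain ⟨M, hM⟩ := exists_one_le_sum_range _
        (fun j => Finset.sum_nonneg fun n _ => hΨ0 n) hdivB (J + N)
      refine ⟨Finset.Ico (2 ^ (J + N)) (2 ^ (J + N + M)), ?_, ?_, ?_⟩
      · intro n hn
        rw [Finset.mem_Ico] at hn
        exact (Nat.lt_two_pow_self.trans_le (Nat.pow_le_pow_right two_pos (by omega))).trans_le hn.1
      · rw [sum_Ico_two_pow]; exact hM
      · rw [sum_Ico_two_pow, sum_Ico_two_pow, Finset.mul_sum]
        refine Finset.sum_le_sum fun i _ => ?_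
        have hj : J ≤ i + (J + N) := by omega
        obtain ⟨h1, h2, -, h4, hE⟩ := hLJ _ hj
        have hsum := sum_prodWeight_totient_ge (γ := γ) hc hdual _ _ h1 h2 h4 hE
        have e1 := hblock1 _ hj
        have e2 := hblock _ hj fun n => (n.totient : ℝ) / n
        simp only [hI] at e1 e2
        rw [e1, e2, mul_left_comm]
        have := hθ0 (i + (J + N))
        gcongr)
  filter_upwards [ae_of_ae_unitAddCircle _ hae] with a ha
  rw [UnitAddCircle.mem_addWellApproximable_iff] at ha
  refine ha.mono ?_
  rintro n ⟨m, hm, -, h⟩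
  have hn : 0 < n := by omega
  have hn0 : (0 : ℝ) < n := by exact_mod_cast hn
  refine ⟨hn, mul_dn_lt_of_dn_lt_weightedRadius (L := L) (J := J) hψ hψ0 n _ ?_⟩
  rw [← AddCircle.coe_sub, ← dn_eq_norm, lt_div_iff₀ hn0] at h
  have h1 : dn (n * a) = dn (n * (a - m / n)) := by
    rw [mul_sub, mul_div_cancel₀ _ hn0.ne', ← dn_add_int (n * a - m) m]
    push_cast; ring_nf
  rw [h1]
  refine (dn_nat_mul_le n _).trans_lt ?_
  rwa [mul_comm]

lemma exists_dual_lower_bound_of_multExp_lt (k : ℕ) (hk : 2 ≤ k) (α : Fin (k - 1) → ℝ)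
    (hα : multExp α < mBound k) :
    ∃ (A : ℕ) (c : ℝ), 0 < c ∧ ∀ (R : ℕ) (m : Fin (k - 1) → ℤ), m ≠ 0 → (∀ i, |m i| ≤ R) →
      c / (R : ℝ) ^ A ≤ dn (∑ i, m i * α i) := by
  obtain ⟨v, hv1, hv2⟩ := EReal.lt_iff_exists_real_btwn.1 hα
  obtain ⟨c, hc, h⟩ := exists_lower_bound_of_multExp_lt α v hv1
  have hk1 : ((k - 1 : ℕ) : ℝ) = (k : ℝ) - 1 := by push_cast [(by omega : 1 ≤ k)]; rfl
  have hk2 : (2 : ℝ) ≤ k := by exact_mod_cast hk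
  refine exists_dual_lower_bound α (max v 0) c hc (le_max_right _ _) ?_ ?_
  · rw [hk1]
    rcases hk.eq_or_lt with rfl | hk3
    · norm_num
    · have hk3' : (2 : ℝ) < k := by exact_mod_cast hk3
      rw [mBound, if_neg hk3.ne', EReal.coe_lt_coe_iff, lt_div_iff₀ (by linarith)] at hv2
      rcases max_choice v 0 with h0 | h0 <;> rw [h0] <;> linarith
  · intro n hn
    refine le_trans ?_ (h n hn)
    have hn1 : (1 : ℝ) ≤ n := by exact_mod_cast hn
    have := Real.rpow_le_rpow_of_exponent_le hn1 (neg_le_neg (le_max_left v 0))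
    gcongr

/-- Theorem: let `k ≥ 2`, `α, γ ∈ ℝ^{k-1}` with `ω^×(α) < (k-1)/(k-2)`
(read as `ω^×(α) < ∞` when `k = 2`), and let `ψ : ℕ → ℝ≥0` be decreasing with
`∑ ψ(n) (log n)^{k-1} = ∞`. Then for almost all `α ∈ ℝ` there are infinitely many
`n ∈ ℕ` with `‖nα₁ - γ₁‖ ⋯ ‖nα_{k-1} - γ_{k-1}‖ ‖nα‖ < ψ(n)`. -/
theorem main_theorem (k : ℕ) (hk : 2 ≤ k) (α γ : Fin (k - 1) → ℝ)
    (hα : multExp α < mBound k)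
    (ψ : ℕ → ℝ) (hψ0 : ∀ n, 0 ≤ ψ n) (hψmono : Antitone ψ)
    (hdiv : ¬ Summable (fun n : ℕ => ψ n * Real.log n ^ (k - 1))) :
    ∀ᵐ a : ℝ ∂(volume : Measure ℝ),
      {n : ℕ | 0 < n ∧ (∏ i, dn (n * α i - γ i)) * dn (n * a) < ψ n}.Infinite := by
  obtain ⟨A, c, hc, hdual⟩ := exists_dual_lower_bound_of_multExp_lt k hk α hα
  exact ae_infinite_of_dual_lower_bound α γ A c hc hdual ψ hψ0 hψmono hdiv
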